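/- arXiv:math/9404202 — 2 statements merged into one kernel-verified Lean document; each statement's English description precedes it below -/
import Mathlib

section
/- Let Γ_T be a finitely generated Ã_n-group with normal form language L. For u = u_1⋯u_ℓ ∈ L and x ∈ Π, let v = v_1⋯v_k ∈ L be the normal form of the group element ū·a_x. Then for every integer t ≥ 0, the word-metric distance d(u(t), v(t)) ≤ 1, where u(t) = a_{u_1}⋯a_{u_min(t,ℓ)} and v(t) = a_{v_1}⋯a_{v_min(t,k)}. Consequently Γ_T satisfies the 1-fellow-traveller property and is an automatic group. -/
/-- An abstract finite projective geometry of dimension `n` with an involution `lam`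
satisfying `lam (Π_i) = Π_{n+1-i}`, together with an Ã_n-triangle presentation `T`
compatible with `lam`, satisfying axioms (A)–(F) of Cartwright–Shapiro.
Here `T' = {(u,v,w) ∈ T : dim u + dim v + dim w = n+1}`. -/
structure TrianglePresentation (n : ℕ) (P : Type*) where
  dim : P → ℕ
  incid : P → P → Prop
  lam : P → P
  T : P → P → P → Prop
  incid_symm : ∀ x y, incid x y → incid y x
  lam_invol : Function.Involutive lam
  dim_mem : ∀ x, 1 ≤ dim x ∧ dim x ≤ n
  lam_dim : ∀ x, dim (lam x) = n + 1 - dim x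
  /-- Axiom (A): `(u,v,w) ∈ T` for some `w` iff `λ(u)` and `v` are distinct and incident. -/
  axiomA : ∀ u v, (∃ w, T u v w) ↔ (lam u ≠ v ∧ incid (lam u) v)
  /-- Axiom (B): cyclic invariance. -/
  axiomB : ∀ u v w, T u v w → T v w u
  /-- Axiom (C): uniqueness of the third vertex. -/
  axiomC : ∀ u v w₁ w₂, T u v w₁ → T u v w₂ → w₁ = w₂
  /-- Axiom (D). -/
  axiomD : ∀ u v w, T u v w → T (lam w) (lam v) (lam u)
  /-- Axiom (E). -/
  axiomE : ∀ u v w, T u v w →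
    dim u + dim v + dim w = n + 1 ∨ dim u + dim v + dim w = 2 * (n + 1)
  /-- Axiom (F), stated for the half `T'` of `T`. -/
  axiomF : ∀ x y u x' y',
    (T x y u ∧ dim x + dim y + dim u = n + 1) →
    (T x' y' (lam u) ∧ dim x' + dim y' + dim (lam u) = n + 1) →
    ∃ w, (T y' x w ∧ dim y' + dim x + dim w = n + 1) ∧
         (T y x' (lam w) ∧ dim y + dim x' + dim (lam w) = n + 1)
  /-- For `u, v ∈ Π`, `(u,v,w) ∈ T'` for some `w` iff `λ(u) ⊋ v`. -/
  exists_T' : ∀ u v,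
    (∃ w, T u v w ∧ dim u + dim v + dim w = n + 1) ↔
      (lam u ≠ v ∧ incid (lam u) v ∧ dim v < dim (lam u))

namespace TrianglePresentation

variable {n : ℕ} {P : Type*} (TP : TrianglePresentation n P)

/-- The half `T'` of `T` consisting of triples with dimension sum `n+1`. -/
def T' (u v w : P) : Prop :=
  TP.T u v w ∧ TP.dim u + TP.dim v + TP.dim w = n + 1

/-- `T'' = T \ T'`. -/
def T'' (u v w : P) : Prop :=
  TP.T u v w ∧ ¬ (TP.dim u + TP.dim v + TP.dim w = n + 1)

/-- `x ⊂ y`: `x` is incident with `y` and `dim x ≤ dim y` (or `x = y`). -/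
def Sub (x y : P) : Prop :=
  x = y ∨ (TP.incid x y ∧ TP.dim x ≤ TP.dim y)

/-- `x ⊊ y`: proper containment. -/
def PSub (x y : P) : Prop :=
  TP.Sub x y ∧ x ≠ y

/-- `x + y = V`: no element of `Π` contains both `x` and `y`. -/
def SumV (x y : P) : Prop :=
  ¬ ∃ z, TP.Sub x z ∧ TP.Sub y z

/-- `x + y = c`: `c` is the join of `x` and `y` in the projective geometry. -/
def JoinEq (x y c : P) : Prop :=
  TP.Sub x c ∧ TP.Sub y c ∧ ∀ z, TP.Sub x z → TP.Sub y z → TP.Sub c z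

end TrianglePresentation

namespace TrianglePresentation

variable {n : ℕ} {P : Type*} (TP : TrianglePresentation n P)

/-- The relators of Γ_T: `a_{λ(v)} a_v` for all `v`, and `a_u a_v a_w` for `(u,v,w) ∈ T`. -/
def rels : Set (FreeGroup P) :=
  {r | (∃ v, r = FreeGroup.of (TP.lam v) * FreeGroup.of v) ∨
       (∃ u v w, TP.T u v w ∧ r = FreeGroup.of u * FreeGroup.of v * FreeGroup.of w)}

/-- The Ã_n-group `Γ_T` presented by the generators `a_v`, `v ∈ Π`, and the above relators. -/
def Gamma := PresentedGroup TP.rels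

instance : Group TP.Gamma := by unfold Gamma; infer_instance

/-- The generator `a_v` of `Γ_T`. -/
def gen (v : P) : TP.Gamma := PresentedGroup.of v

/-- The image `ū = a_{u₁} ⋯ a_{u_ℓ}` in `Γ_T` of a string over `Π`. -/
def wordProd (w : List P) : TP.Gamma := (w.map TP.gen).prod

/-- The normal-form language `L`: strings with `λ(u_i) + u_{i+1} = V` for consecutive
letters. -/
def Lang : Set (List P) := {w | w.Chain' (fun a b => TP.SumV (TP.lam a) b)}

/-- The word length `|g|` of `g ∈ Γ_T` with respect to the generators `a_v`, `v ∈ Π`. -/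
noncomputable def wlen (g : TP.Gamma) : ℕ :=
  sInf {ℓ | ∃ w : List P, TP.wordProd w = g ∧ w.length = ℓ}

end TrianglePresentation

namespace TrianglePresentation

variable {n : ℕ} {P : Type*} {TP : TrianglePresentation n P}

/-- `a c = b` with dimensions adding up: the partial multiplication on `Π` given by `T'`. -/
def PMul (TP : TrianglePresentation n P) (a c b : P) : Prop :=
  TP.T' a c (TP.lam b)

/-- Adjacency (or equality) in the Cayley graph of `Γ_T`. -/
def Adj (TP : TrianglePresentation n P) (g h : TP.Gamma) : Prop :=
  g = h ∨ ∃ x : P, g = h * TP.gen x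

/-- The paths spelled by `u` and `v` stay at distance at most one. -/
def FellowTravel (TP : TrianglePresentation n P) (u v : List P) : Prop :=
  ∀ t : ℕ, TP.Adj (TP.wordProd (u.take t)) (TP.wordProd (v.take t))

/-! ### The partial multiplication -/

theorem T'_rotate {a b c : P} (h : TP.T' a b c) : TP.T' b c a :=
  ⟨TP.axiomB _ _ _ h.1, by have := h.2; omega⟩

theorem PMul.rotate {a c b : P} (h : TP.PMul a c b) : TP.PMul c (TP.lam b) (TP.lam a) := by
  unfold PMul
  rw [TP.lam_invol]
  exact T'_rotate h

theorem PMul.rotate_rotate {a c b : P} (h : TP.PMul a c b) :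
    TP.PMul (TP.lam b) a (TP.lam c) := by
  have := h.rotate.rotate
  rwa [TP.lam_invol] at this

theorem PMul.right_unique {a c b b' : P} (h : TP.PMul a c b) (h' : TP.PMul a c b') : b = b' :=
  TP.lam_invol.injective (TP.axiomC _ _ _ _ h.1 h'.1)

theorem PMul.left_unique {a a' c b : P} (h : TP.PMul a c b) (h' : TP.PMul a' c b) : a = a' :=
  TP.axiomC _ _ _ _ (T'_rotate h).1 (T'_rotate h').1

theorem PMul.assoc {a b c d e : P} (h : TP.PMul a b c) (h' : TP.PMul c d e) :
    ∃ f, TP.PMul b d f ∧ TP.PMul a f e := by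
  obtain ⟨w, hw, hw'⟩ := TP.axiomF d (TP.lam e) c a b (T'_rotate h') h
  refine ⟨TP.lam w, ?_, ?_⟩
  · unfold PMul
    rw [TP.lam_invol]
    exact hw
  · exact T'_rotate hw'

theorem PMul.assoc' {a b d e f : P} (h : TP.PMul b d f) (h' : TP.PMul a f e) :
    ∃ c, TP.PMul a b c ∧ TP.PMul c d e := by
  obtain ⟨g, hg, hg'⟩ := h.assoc h'.rotate
  refine ⟨TP.lam g, ?_, ?_⟩
  · simpa [TP.lam_invol a] using hg'.rotate_rotate
  · simpa [TP.lam_invol e] using hg.rotate_rotate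

theorem gen_lam (a : P) : TP.gen (TP.lam a) = (TP.gen a)⁻¹ := by
  rw [eq_inv_iff_mul_eq_one]
  exact PresentedGroup.one_of_mem (rels := TP.rels) (Or.inl ⟨a, rfl⟩)

theorem PMul.gen_mul {a c b : P} (h : TP.PMul a c b) : TP.gen a * TP.gen c = TP.gen b := by
  have : TP.gen a * TP.gen c * TP.gen (TP.lam b) = 1 :=
    PresentedGroup.one_of_mem (rels := TP.rels) (Or.inr ⟨_, _, _, h.1, rfl⟩)
  rw [gen_lam] at this
  exact mul_inv_eq_one.mp this

theorem PMul.dim_lt {a c b : P} (h : TP.PMul a c b) : TP.dim a < TP.dim b := by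
  have h1 := h.2
  have h2 := TP.lam_dim b
  have h3 := TP.dim_mem b
  have h4 := TP.dim_mem c
  omega

/-! ### Containment -/

theorem exists_pMul_iff {a b : P} :
    (∃ c, TP.PMul a c b) ↔ TP.incid a b ∧ TP.dim a < TP.dim b := by
  have h := TP.exists_T' (TP.lam b) a
  rw [TP.lam_invol] at h
  constructor
  · rintro ⟨c, hc⟩
    obtain ⟨-, h2, h3⟩ := h.1 ⟨c, T'_rotate (T'_rotate hc)⟩
    exact ⟨TP.incid_symm _ _ h2, h3⟩
  · rintro ⟨h2, h3⟩
    obtain ⟨w, hw⟩ := h.2 ⟨by rintro rfl; omega, TP.incid_symm _ _ h2, h3⟩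
    exact ⟨w, T'_rotate hw⟩

theorem eq_of_incid_of_dim_eq {a b : P} (h : TP.incid a b) (hd : TP.dim a = TP.dim b) :
    a = b := by
  by_contra hne
  obtain ⟨w, hw⟩ := (TP.axiomA (TP.lam a) b).2 (by rw [TP.lam_invol]; exact ⟨hne, h⟩)
  have h1 := TP.axiomE _ _ _ hw
  have h2 := TP.lam_dim a
  have h3 := TP.dim_mem a
  have h4 := TP.dim_mem w
  omega

theorem sub_iff {a b : P} : TP.Sub a b ↔ a = b ∨ ∃ c, TP.PMul a c b := by
  rw [exists_pMul_iff]
  constructor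
  · rintro (h | ⟨h, hd⟩)
    · exact Or.inl h
    · rcases hd.eq_or_lt with hd | hd
      · exact Or.inl (eq_of_incid_of_dim_eq h hd)
      · exact Or.inr ⟨h, hd⟩
  · rintro (h | ⟨h, hd⟩)
    · exact Or.inl h
    · exact Or.inr ⟨h, hd.le⟩

theorem PMul.sub {a c b : P} (h : TP.PMul a c b) : TP.Sub a b :=
  sub_iff.2 (Or.inr ⟨c, h⟩)

theorem sub_refl (a : P) : TP.Sub a a := Or.inl rfl

theorem Sub.trans {a b c : P} (h : TP.Sub a b) (h' : TP.Sub b c) : TP.Sub a c := by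
  rcases sub_iff.1 h with rfl | ⟨d, hd⟩
  · exact h'
  rcases sub_iff.1 h' with rfl | ⟨e, he⟩
  · exact h
  obtain ⟨f, -, hf⟩ := hd.assoc he
  exact hf.sub

theorem SumV.mono_right {a b c : P} (h : TP.SumV a b) (hbc : TP.Sub b c) : TP.SumV a c :=
  fun ⟨z, hz, hz'⟩ => h ⟨z, hz, hbc.trans hz'⟩

/-- Left multiplication by `p` preserves containment. -/
theorem PMul.sub_of_sub {p a b a' b' : P} (ha : TP.PMul p a a') (hb : TP.PMul p b b')
    (h : TP.Sub a b) : TP.Sub a' b' := by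
  rcases sub_iff.1 h with rfl | ⟨d, hd⟩
  · exact Or.inl (ha.right_unique hb)
  obtain ⟨c, hc, hc'⟩ := hd.assoc' hb
  rw [ha.right_unique hc]
  exact hc'.sub

/-! ### Joins -/

/-- The complements of two incomparable points in a minimal upper bound have no common
right divisor. -/
theorem sumV_of_minimal {a b p s y : P} (hp : TP.PMul a p y) (hs : TP.PMul b s y)
    (hab : ¬ TP.Sub a b) (hba : ¬ TP.Sub b a)
    (hmin : ∀ z, TP.Sub a z → TP.Sub b z → TP.Sub z y → z = y) :
    TP.SumV (TP.lam p) (TP.lam s) := by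
  rintro ⟨z, hz, hz'⟩
  rcases sub_iff.1 hz with rfl | ⟨e, he⟩
  · rcases sub_iff.1 hz' with h | ⟨f, hf⟩
    · obtain rfl := TP.lam_invol.injective h
      exact hab (Or.inl (hp.left_unique hs))
    · have hf' := hf.rotate
      rw [TP.lam_invol, TP.lam_invol] at hf'
      obtain ⟨c, hc, hc'⟩ := hf'.assoc' hs
      rw [hc'.left_unique hp] at hc
      exact hba hc.sub
  · have he' := he.rotate
    rw [TP.lam_invol] at he'
    rcases sub_iff.1 hz' with rfl | ⟨f, hf⟩
    · rw [TP.lam_invol] at he'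
      obtain ⟨c, hc, hc'⟩ := he'.assoc' hp
      rw [hc'.left_unique hs] at hc
      exact hab hc.sub
    · have hf' := hf.rotate
      rw [TP.lam_invol] at hf'
      obtain ⟨c, hc, hc'⟩ := he'.assoc' hp
      obtain ⟨d, hd, hd'⟩ := hf'.assoc' hs
      rw [hd'.left_unique hc'] at hd
      have := hmin c hc.sub hd.sub hc'.sub
      have := hc'.dim_lt
      simp_all

theorem exists_minimal_upper_bound {a b w : P} (ha : TP.Sub a w) (hb : TP.Sub b w) :
    ∃ y, TP.Sub a y ∧ TP.Sub b y ∧ TP.Sub y w ∧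
      ∀ z, TP.Sub a z → TP.Sub b z → TP.Sub z y → z = y := by
  induction hd : TP.dim w using Nat.strong_induction_on generalizing w with
  | _ d ih =>
    by_cases h : ∀ z, TP.Sub a z → TP.Sub b z → TP.Sub z w → z = w
    · exact ⟨w, ha, hb, sub_refl w, h⟩
    · push Not at h
      obtain ⟨z, hz, hz', hzw, hne⟩ := h
      obtain ⟨c, hc⟩ := (sub_iff.1 hzw).resolve_left hne
      obtain ⟨y, h1, h2, h3, h4⟩ := ih (TP.dim z) (hd ▸ hc.dim_lt) hz hz' rfl
      exact ⟨y, h1, h2, h3.trans hzw, h4⟩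

theorem wordProd_append (u v : List P) :
    TP.wordProd (u ++ v) = TP.wordProd u * TP.wordProd v := by
  simp [wordProd]

theorem wordProd_singleton (a : P) : TP.wordProd [a] = TP.gen a := by
  simp [wordProd]

theorem mem_lang_iff {w : List P} :
    w ∈ TP.Lang ↔ w.IsChain (fun a b => TP.SumV (TP.lam a) b) := Iff.rfl

theorem append_pair_mem_lang {u : List P} {a b : P} :
    u ++ [a] ++ [b] ∈ TP.Lang ↔ u ++ [a] ∈ TP.Lang ∧ TP.SumV (TP.lam a) b := by
  rw [mem_lang_iff, mem_lang_iff, List.isChain_append]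
  simp

theorem mem_lang_of_append {u v : List P} (h : u ++ v ∈ TP.Lang) : u ∈ TP.Lang := by
  rw [mem_lang_iff] at h ⊢
  exact (List.isChain_append.1 h).1

theorem singleton_mem_lang (a : P) : [a] ∈ TP.Lang :=
  mem_lang_iff.2 (List.isChain_singleton a)

theorem append_mem_lang_of_sub {u : List P} {a b : P} (h : u ++ [a] ∈ TP.Lang)
    (hab : TP.Sub a b) : u ++ [b] ∈ TP.Lang := by
  rcases List.eq_nil_or_concat u with rfl | ⟨w, c, rfl⟩
  · exact singleton_mem_lang b
  · rw [List.concat_eq_append, append_pair_mem_lang] at h ⊢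
    exact ⟨h.1, h.2.mono_right hab⟩

theorem pair_mem_lang {a b : P} (h : TP.SumV (TP.lam a) b) : [a, b] ∈ TP.Lang :=
  (append_pair_mem_lang (u := [])).2 ⟨singleton_mem_lang a, h⟩

theorem minimal_upper_bound_unique (hinj : Set.InjOn TP.wordProd TP.Lang) {a b y y' : P}
    (hab : ¬ TP.Sub a b) (hba : ¬ TP.Sub b a) (ha : TP.Sub a y) (hb : TP.Sub b y)
    (hmin : ∀ z, TP.Sub a z → TP.Sub b z → TP.Sub z y → z = y)
    (ha' : TP.Sub a y') (hb' : TP.Sub b y')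
    (hmin' : ∀ z, TP.Sub a z → TP.Sub b z → TP.Sub z y' → z = y') : y = y' := by
  obtain ⟨p, hp⟩ := (sub_iff.1 ha).resolve_left (by rintro rfl; exact hba hb)
  obtain ⟨s, hs⟩ := (sub_iff.1 hb).resolve_left (by rintro rfl; exact hab ha)
  obtain ⟨p', hp'⟩ := (sub_iff.1 ha').resolve_left (by rintro rfl; exact hba hb')
  obtain ⟨s', hs'⟩ := (sub_iff.1 hb').resolve_left (by rintro rfl; exact hab ha')
  have key : ∀ {p s y}, TP.PMul a p y → TP.PMul b s y →
      TP.wordProd [p, TP.lam s] = (TP.gen a)⁻¹ * TP.gen b := by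
    intro p s y hp hs
    have : TP.gen a * TP.gen p = TP.gen b * TP.gen s := hp.gen_mul.trans hs.gen_mul.symm
    simp only [wordProd, List.map_cons, List.map_nil, List.prod_cons, List.prod_nil, mul_one,
      gen_lam]
    rw [eq_inv_mul_iff_mul_eq, ← mul_assoc, this, mul_inv_cancel_right]
  have h := hinj (pair_mem_lang (sumV_of_minimal hp hs hab hba hmin))
    (pair_mem_lang (sumV_of_minimal hp' hs' hab hba hmin')) ((key hp hs).trans (key hp' hs').symm)
  obtain ⟨rfl, -⟩ := List.cons.inj h
  exact hp.right_unique hp'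

theorem exists_joinEq (hinj : Set.InjOn TP.wordProd TP.Lang) {a b : P}
    (h : ¬ TP.SumV a b) : ∃ k, TP.JoinEq a b k := by
  obtain ⟨w, haw, hbw⟩ := not_not.1 h
  by_cases hab : TP.Sub a b
  · exact ⟨b, hab, sub_refl b, fun z _ hz => hz⟩
  by_cases hba : TP.Sub b a
  · exact ⟨a, sub_refl a, hba, fun z hz _ => hz⟩
  obtain ⟨y, h1, h2, -, h4⟩ := exists_minimal_upper_bound haw hbw
  refine ⟨y, h1, h2, fun z hz hz' => ?_⟩
  obtain ⟨y', h1', h2', h3', h4'⟩ := exists_minimal_upper_bound hz hz'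
  rwa [minimal_upper_bound_unique hinj hab hba h1 h2 h4 h1' h2' h4']

/-- Two incomparable points with a common upper bound have complements without common right
divisor in some upper bound. -/
theorem exists_pMul_sumV {a b : P} (h : ¬ TP.SumV a b)
    (hab : ¬ TP.Sub a b) (hba : ¬ TP.Sub b a) :
    ∃ y p s, TP.PMul a p y ∧ TP.PMul b s y ∧ TP.SumV (TP.lam p) (TP.lam s) := by
  obtain ⟨w, haw, hbw⟩ := not_not.1 h
  obtain ⟨y, h1, h2, -, h4⟩ := exists_minimal_upper_bound haw hbw
  obtain ⟨p, hp⟩ := (sub_iff.1 h1).resolve_left (by rintro rfl; exact hba h2)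
  obtain ⟨s, hs⟩ := (sub_iff.1 h2).resolve_left (by rintro rfl; exact hab h1)
  exact ⟨y, p, s, hp, hs, sumV_of_minimal hp hs hab hba h4⟩

/-- If `b + A = V`, `A = p c` and `b ⊂ p e`, then `e + q = V` for every `q ⊃ c` with
`λ(p) + q = V`. -/
theorem sumV_of_pMul (hinj : Set.InjOn TP.wordProd TP.Lang) {b A p c e y q : P}
    (hbA : TP.SumV b A) (hc : TP.PMul p c A) (he : TP.PMul p e y) (hy : TP.Sub b y)
    (hpq : TP.SumV (TP.lam p) q) (hcq : TP.Sub c q) : TP.SumV e q := by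
  rintro ⟨w, hew, hqw⟩
  obtain ⟨k, hek, hck, hk⟩ := exists_joinEq hinj (a := e) (b := c)
    (not_not.2 ⟨w, hew, hcq.trans hqw⟩)
  have hkp := hk _ he.rotate.sub hc.rotate.sub
  have hkw := hk _ hew (hcq.trans hqw)
  obtain ⟨j, hj⟩ := (sub_iff.1 hkp).resolve_left (by rintro rfl; exact hpq ⟨w, hkw, hqw⟩)
  have hj' := hj.rotate_rotate
  rw [TP.lam_invol] at hj'
  exact hbA ⟨_, hy.trans (he.sub_of_sub hj' hek), hc.sub_of_sub hj' hck⟩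

/-! ### Fellow travelling -/

theorem Adj.refl (g : TP.Gamma) : TP.Adj g g := Or.inl rfl

theorem Adj.of_mul_eq {g h : TP.Gamma} {x : P} (e : h = g * TP.gen x) : TP.Adj g h :=
  Or.inr ⟨TP.lam x, by rw [e, gen_lam, mul_inv_cancel_right]⟩

theorem wlen_wordProd_le (w : List P) : TP.wlen (TP.wordProd w) ≤ w.length :=
  Nat.sInf_le ⟨w, rfl, rfl⟩

theorem Adj.wlen_le {g h : TP.Gamma} (hgh : TP.Adj g h) : TP.wlen (g⁻¹ * h) ≤ 1 := by
  rcases hgh with rfl | ⟨x, rfl⟩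
  · have := wlen_wordProd_le (TP := TP) []
    simp only [wordProd, List.map_nil, List.prod_nil, List.length_nil] at this
    rw [inv_mul_cancel]
    omega
  · have := wlen_wordProd_le (TP := TP) [TP.lam x]
    rw [wordProd_singleton, gen_lam] at this
    simpa using this

/-- Words that agree with fellow travelling prefixes up to `u` and end at adjacent points. -/
theorem FellowTravel.of_append {u v : List P} {A x : P}
    (h : ∀ t ≤ u.length, TP.Adj (TP.wordProd (u.take t)) (TP.wordProd (v.take t)))
    (hv : v.length ≤ u.length + 1)
    (e : TP.wordProd v = TP.wordProd (u ++ [A]) * TP.gen x) : TP.FellowTravel (u ++ [A]) v := by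
  intro t
  rcases le_or_gt t u.length with ht | ht
  · rw [List.take_append_of_le_length ht]
    exact h t ht
  · rw [List.take_of_length_le (by simpa using ht), List.take_of_length_le (by omega)]
    exact Adj.of_mul_eq e

theorem fellowTravel_append (u : List P) (x : P) : TP.FellowTravel u (u ++ [x]) := by
  intro t
  rcases le_or_gt t u.length with ht | ht
  · rw [List.take_append_of_le_length ht]
    exact Adj.refl _
  · rw [List.take_of_length_le ht.le, List.take_of_length_le (by simpa using ht),
      wordProd_append, wordProd_singleton]
    exact Adj.of_mul_eq rfl

theorem FellowTravel.append_append {u v : List P} {A p c q x : P} (h : TP.FellowTravel u v)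
    (hlen : u.length ≤ v.length) (hlen' : v.length ≤ u.length + 1)
    (hv : TP.wordProd v = TP.wordProd u * TP.gen p) (hc : TP.PMul p c A)
    (e : TP.wordProd (v ++ [q]) = TP.wordProd (u ++ [A]) * TP.gen x) :
    TP.FellowTravel (u ++ [A]) (v ++ [q]) := by
  intro t
  rcases le_or_gt t u.length with ht | ht
  · rw [List.take_append_of_le_length ht, List.take_append_of_le_length (ht.trans hlen)]
    exact h t
  rw [List.take_of_length_le (by simpa using ht)]
  rcases le_or_gt t v.length with htv | htv
  · rw [List.take_append_of_le_length htv, List.take_of_length_le (by omega), hv,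
      wordProd_append, wordProd_singleton, ← hc.gen_mul]
    exact Or.inr ⟨c, (mul_assoc _ _ _).symm⟩
  · rw [List.take_of_length_le (by simpa using htv)]
    exact Adj.of_mul_eq e

/-- Rewriting of `a⁻¹ b` through a common upper bound. -/
theorem PMul.gen_mul_gen {B x p s y : P} (hp : TP.PMul (TP.lam B) p y) (hs : TP.PMul x s y) :
    TP.gen B * TP.gen x = TP.gen p * TP.gen (TP.lam s) := by
  have := hp.gen_mul.trans hs.gen_mul.symm
  rw [gen_lam, inv_mul_eq_iff_eq_mul, ← mul_assoc] at this
  rw [gen_lam, this, mul_inv_cancel_right]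

theorem exists_normalForm_of_pMul (hinj : Set.InjOn TP.wordProd TP.Lang) (u : List P) :
    ∀ A p c, u ++ [A] ∈ TP.Lang → TP.PMul p c A →
      ∃ v, TP.wordProd v = TP.wordProd u * TP.gen p ∧ u.length ≤ v.length ∧
        v.length ≤ u.length + 1 ∧ TP.FellowTravel u v ∧
        ∀ q, TP.SumV (TP.lam p) q → TP.Sub c q → v ++ [q] ∈ TP.Lang := by
  induction u using List.reverseRecOn with
  | nil =>
    intro A p c _ _
    exact ⟨[p], by simp [wordProd], by simp, by simp, fellowTravel_append [] p,
      fun q hq _ => pair_mem_lang hq⟩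
  | append_singleton u B ih =>
    intro A p c hA hc
    obtain ⟨hB, hBA⟩ := append_pair_mem_lang.1 hA
    by_cases hsum : TP.SumV (TP.lam B) p
    · refine ⟨u ++ [B] ++ [p], ?_, by simp, by simp, fellowTravel_append _ p, fun q hq _ => ?_⟩
      · rw [wordProd_append, wordProd_singleton]
      · exact append_pair_mem_lang.2 ⟨append_pair_mem_lang.2 ⟨hB, hsum⟩, hq⟩
    have hBp : ¬ TP.Sub (TP.lam B) p := fun h => hBA ⟨A, h.trans hc.sub, sub_refl A⟩
    by_cases hpB : TP.Sub p (TP.lam B)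
    · obtain ⟨e, he⟩ := (sub_iff.1 hpB).resolve_left (by rintro rfl; exact hBp hpB)
      have he' := he.rotate_rotate
      rw [TP.lam_invol] at he'
      have hw : TP.wordProd (u ++ [TP.lam e]) = TP.wordProd (u ++ [B]) * TP.gen p := by
        rw [wordProd_append, wordProd_append, wordProd_singleton, wordProd_singleton,
          ← he'.gen_mul, mul_assoc]
      refine ⟨u ++ [TP.lam e], hw, by simp, by simp, ?_, fun q hq hcq => ?_⟩
      · refine FellowTravel.of_append (fun t ht => ?_) (by simp) hw
        rw [List.take_append_of_le_length ht]
        exact Adj.refl _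
      · refine append_pair_mem_lang.2 ⟨append_mem_lang_of_sub hB he'.sub, ?_⟩
        rw [TP.lam_invol]
        exact sumV_of_pMul hinj hBA hc he (sub_refl _) hq hcq
    · obtain ⟨y, p₁, s, hp₁, hs, hps⟩ := exists_pMul_sumV hsum hBp hpB
      have hc₁ := hp₁.rotate
      rw [TP.lam_invol] at hc₁
      obtain ⟨v, hv, hl, hl', hft, hext⟩ := ih B p₁ _ hB hc₁
      have hw : TP.wordProd (v ++ [TP.lam s]) = TP.wordProd (u ++ [B]) * TP.gen p := by
        rw [wordProd_append, wordProd_append, wordProd_singleton, wordProd_singleton, hv,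
          mul_assoc, mul_assoc, hp₁.gen_mul_gen hs]
      refine ⟨v ++ [TP.lam s], hw, by simpa using hl, by simpa using hl',
        hft.append_append hl hl' hv hc₁ hw, fun q hq hcq => ?_⟩
      refine append_pair_mem_lang.2 ⟨hext _ hps hs.rotate_rotate.sub, ?_⟩
      rw [TP.lam_invol]
      exact sumV_of_pMul hinj hBA hc hs hp₁.sub hq hcq

theorem fellowTravel_of_mem_lang (hbij : Set.BijOn TP.wordProd TP.Lang Set.univ)
    (hgeo : ∀ w ∈ TP.Lang, TP.wlen (TP.wordProd w) = w.length) (u : List P) :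
    ∀ x v, u ∈ TP.Lang → v ∈ TP.Lang → TP.wordProd v = TP.wordProd u * TP.gen x →
      TP.FellowTravel u v := by
  induction u using List.reverseRecOn with
  | nil =>
    intro x v _ hv hvx
    have : v = [] ++ [x] := hbij.injOn hv (singleton_mem_lang x) (by
      rw [hvx]; simp [wordProd])
    rw [this]
    exact fellowTravel_append [] x
  | append_singleton u A ih =>
    intro x v hu hv hvx
    have hvx' : TP.wordProd v = TP.wordProd u * (TP.gen A * TP.gen x) := by
      rw [hvx, wordProd_append, wordProd_singleton, mul_assoc]
    by_cases hsum : TP.SumV (TP.lam A) x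
    · have : v = u ++ [A] ++ [x] := hbij.injOn hv (append_pair_mem_lang.2 ⟨hu, hsum⟩) (by
        rw [hvx, wordProd_append _ [x], wordProd_singleton])
      rw [this]
      exact fellowTravel_append _ x
    have single : ∀ r, TP.gen A * TP.gen x = TP.gen r → TP.FellowTravel (u ++ [A]) v := by
      intro r hr
      rw [hr] at hvx'
      refine FellowTravel.of_append (fun t _ => ih r v (mem_lang_of_append hu) hv hvx' t) ?_ hvx
      rw [← hgeo v hv, hvx', ← wordProd_singleton, ← wordProd_append]
      simpa using wlen_wordProd_le (TP := TP) (u ++ [r])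
    by_cases hAx : TP.Sub (TP.lam A) x
    · rcases sub_iff.1 hAx with rfl | ⟨p, hp⟩
      · have : v = u := hbij.injOn hv (mem_lang_of_append hu) (by
          rw [hvx', gen_lam, mul_inv_cancel, mul_one])
        subst this
        refine FellowTravel.of_append (fun t _ => Adj.refl _) (by simp) hvx
      · refine single p ?_
        rw [← hp.gen_mul, gen_lam, mul_inv_cancel_left]
    by_cases hxA : TP.Sub x (TP.lam A)
    · obtain ⟨e, he⟩ := (sub_iff.1 hxA).resolve_left (by rintro rfl; exact hAx hxA)
      have he' := he.rotate_rotate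
      rw [TP.lam_invol] at he'
      exact single _ he'.gen_mul
    obtain ⟨y, p, s, hp, hs, hps⟩ := exists_pMul_sumV hsum hAx hxA
    have hc := hp.rotate
    rw [TP.lam_invol] at hc
    obtain ⟨w, hw, hl, hl', hft, hext⟩ := exists_normalForm_of_pMul hbij.injOn u A p _ hu hc
    have : v = w ++ [TP.lam s] :=
      hbij.injOn hv (hext _ hps hs.rotate_rotate.sub) (by
        rw [hvx', wordProd_append, wordProd_singleton, hw, mul_assoc, hp.gen_mul_gen hs])
    subst this
    exact hft.append_append hl hl' hw hc hvx

end TrianglePresentation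

/-- Theorem 2 (fellow traveller property): let `Γ_T` be a finitely generated Ã_n-group
with normal-form language `L`. For `u ∈ L`, `x ∈ Π`, and `v ∈ L` the normal form of
`ū · a_x`, we have `d(u(t), v(t)) ≤ 1` for every `t ≥ 0`: either
`a_{u₁}⋯a_{u_t} = a_{v₁}⋯a_{v_t}`, or `a_{u₁}⋯a_{u_t} = a_{v₁}⋯a_{v_t} · a_{x_t}` for
some `x_t ∈ Π`. (Hypotheses: `u ↦ ū` is a bijection `L → Γ_T`, words of `L` are geodesic.) -/
theorem fellow_traveller {n : ℕ} {P : Type*} [Fintype P] (TP : TrianglePresentation n P)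
    (hbij : Set.BijOn TP.wordProd TP.Lang Set.univ)
    (hgeo : ∀ w ∈ TP.Lang, TP.wlen (TP.wordProd w) = w.length)
    (u : List P) (hu : u ∈ TP.Lang) (x : P)
    (v : List P) (hv : v ∈ TP.Lang)
    (hvx : TP.wordProd v = TP.wordProd u * TP.gen x) :
    ∀ t : ℕ,
      TP.wlen ((TP.wordProd (u.take t))⁻¹ * TP.wordProd (v.take t)) ≤ 1 ∧
      (TP.wordProd (u.take t) = TP.wordProd (v.take t) ∨
        ∃ xt : P, TP.wordProd (u.take t) = TP.wordProd (v.take t) * TP.gen xt) := by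
  intro t
  have h := TrianglePresentation.fellowTravel_of_mem_lang hbij hgeo u x v hu hv hvx t
  exact ⟨h.wlen_le, h⟩
end

section
/- Suppose Γ is a connected graph with the property that there is a constant K such that for any bigon σ, σ' (two geodesics with common endpoints, where endpoints need not be vertices), σ and σ' each lie in the K-neighborhood of each other. If moreover any bigon whose two endpoints are both vertices lies in a subgraph isometric to a fixed δ-hyperbolic graph (an 'apartment'), and the three reduction cases of Cartwright–Shapiro hold, then Γ is hyperbolic. In particular (Papasoglu's criterion): a graph in which all bigons are uniformly K-thin is hyperbolic. -/
/-- A geodesic segment of length `L` parametrized by arc length. -/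
def IsGeodesicSegment {X : Type*} [MetricSpace X] (L : ℝ) (σ : ℝ → X) : Prop :=
  0 ≤ L ∧ ∀ s ∈ Set.Icc (0:ℝ) L, ∀ t ∈ Set.Icc (0:ℝ) L, dist (σ s) (σ t) = |s - t|

/-- Every pair of points is joined by a geodesic. -/
def IsGeodesicSpace (X : Type*) [MetricSpace X] : Prop :=
  ∀ x y : X, ∃ σ : ℝ → X, IsGeodesicSegment (dist x y) σ ∧ σ 0 = x ∧ σ (dist x y) = y

/-- δ-hyperbolicity via thin geodesic triangles. -/
def DeltaHyperbolic (X : Type*) [MetricSpace X] (δ : ℝ) : Prop :=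
  ∀ (x y z : X) (a b c : ℝ) (α β γ : ℝ → X),
    IsGeodesicSegment a α → α 0 = x → α a = y →
    IsGeodesicSegment b β → β 0 = y → β b = z →
    IsGeodesicSegment c γ → γ 0 = z → γ c = x →
    ∀ s ∈ Set.Icc (0:ℝ) a, ∃ q ∈ (β '' Set.Icc (0:ℝ) b) ∪ (γ '' Set.Icc (0:ℝ) c),
      dist (α s) q ≤ δ

/-- An integer-valued metric in which distances are realized by chains of unit steps. -/
structure IsGraphDist {W : Type*} (d : W → W → ℕ) : Prop where
  self : ∀ v, d v v = 0
  eq_of_zero : ∀ v w, d v w = 0 → v = w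
  symm : ∀ v w, d v w = d w v
  tri : ∀ u v w, d u w ≤ d u v + d v w
  step : ∀ v w, d v w ≠ 0 → ∃ u, d v u = 1 ∧ d u w + 1 = d v w

/-- `γ` restricted to `0, …, n` is a discrete geodesic. -/
def DiscreteGeodesic {W : Type*} (d : W → W → ℕ) (n : ℕ) (γ : ℕ → W) : Prop :=
  ∀ i j, i ≤ j → j ≤ n → d (γ i) (γ j) = j - i

/-- Discrete geodesics issuing from a common point and ending at points at distance at most
one stay `K`-close. -/
def GeodesicsFellowTravel {W : Type*} (d : W → W → ℕ) (K : ℕ) : Prop :=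
  ∀ (n n' : ℕ) (γ γ' : ℕ → W), DiscreteGeodesic d n γ → DiscreteGeodesic d n' γ' →
    γ 0 = γ' 0 → d (γ n) (γ' n') ≤ 1 → ∀ i, d (γ (min i n)) (γ' (min i n')) ≤ K

namespace DiscreteGeodesic

variable {W : Type*} {d : W → W → ℕ}

theorem mono {n m : ℕ} {γ : ℕ → W} (h : DiscreteGeodesic d n γ) (hm : m ≤ n) :
    DiscreteGeodesic d m γ := fun i j hij hj => h i j hij (hj.trans hm)

theorem shift {n m k : ℕ} {γ : ℕ → W} (h : DiscreteGeodesic d n γ) (hm : k + m ≤ n) :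
    DiscreteGeodesic d m (fun i => γ (k + i)) := fun i j hij hj => by
  have := h (k + i) (k + j) (by omega) (by omega)
  simp only [this]; omega

theorem reverse (hd : IsGraphDist d) {n m k : ℕ} {γ : ℕ → W} (h : DiscreteGeodesic d n γ)
    (hk : k ≤ n) (hm : m ≤ k) : DiscreteGeodesic d m (fun i => γ (k - i)) :=
  fun i j hij hj => by
  have := h (k - j) (k - i) (by omega) (by omega)
  simp only [hd.symm (γ (k - i)), this]; omega

theorem append (hd : IsGraphDist d) {n m : ℕ} {γ η : ℕ → W} (hγ : DiscreteGeodesic d n γ)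
    (hη : DiscreteGeodesic d m η) (h : γ n = η 0) (hl : n + m ≤ d (γ 0) (η m)) :
    DiscreteGeodesic d (n + m) (fun i => if i ≤ n then γ i else η (i - n)) := by
  intro i j hij hj
  by_cases hjn : j ≤ n
  · simp only [hjn, hij.trans hjn, if_true]; exact hγ i j hij hjn
  by_cases hin : i ≤ n
  · simp only [hjn, hin, if_true, if_false]
    have h1 := hγ i n hin le_rfl
    have h2 := hη 0 (j - n) (by omega) (by omega)
    have h3 := hη (j - n) m (by omega) le_rfl
    have h4 := hγ 0 i (by omega) hin
    have h5 := hd.tri (γ i) (γ n) (η (j - n))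
    have h6 := hd.tri (γ 0) (γ i) (η m)
    have h7 := hd.tri (γ i) (η (j - n)) (η m)
    rw [h] at h5 h1
    omega
  · simp only [hjn, hin, if_false]
    rw [hη (i - n) (j - n) (by omega) (by omega)]; omega

/-- Two geodesics whose lengths add up to the distance between the far ends concatenate. -/
theorem exists_append (hd : IsGraphDist d) {n m : ℕ} {γ η : ℕ → W}
    (hγ : DiscreteGeodesic d n γ) (hη : DiscreteGeodesic d m η) (h : γ n = η 0)
    (hl : n + m ≤ d (γ 0) (η m)) :
    ∃ θ : ℕ → W, DiscreteGeodesic d (n + m) θ ∧ (∀ i ≤ n, θ i = γ i) ∧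
      ∀ i, θ (n + i) = η i := by
  refine ⟨_, hγ.append hd hη h hl, fun i hi => if_pos hi, fun i => ?_⟩
  simp only [add_tsub_cancel_left]
  split_ifs with hi
  · obtain rfl : i = 0 := by omega
    exact h
  · rfl

theorem _root_.IsGraphDist.exists_discreteGeodesic (hd : IsGraphDist d) (v w : W) :
    ∃ γ : ℕ → W, DiscreteGeodesic d (d v w) γ ∧ γ 0 = v ∧ γ (d v w) = w := by
  generalize hn : d v w = n
  induction n generalizing v with
  | zero =>
    refine ⟨fun _ => v, fun i j _ hj => ?_, rfl, hd.eq_of_zero _ _ hn⟩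
    rw [hd.self]; omega
  | succ n ih =>
    obtain ⟨u, hu, hu'⟩ := hd.step v w (by omega)
    obtain ⟨γ, hγ, h0, h1⟩ := ih u (by omega)
    have hs : DiscreteGeodesic d 1 (fun i => if i = 0 then v else u) := by
      intro i j hij hj
      obtain rfl | rfl : j = 0 ∨ j = 1 := by omega
      · obtain rfl : i = 0 := by omega
        simp [hd.self]
      · obtain rfl | rfl : i = 0 ∨ i = 1 := by omega
        · simpa using hu
        · simp [hd.self]
    have := hs.append hd hγ (by simp [h0]) (by simp [h1]; omega)
    refine ⟨_, by rwa [add_comm] at this, by simp, ?_⟩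
    by_cases hn0 : n = 0
    · subst hn0; simp [← h0, h1]
    · simp [hn0, h1]

end DiscreteGeodesic

namespace GeodesicsFellowTravel

variable {W : Type*} {d : W → W → ℕ} {K : ℕ}

theorem dist_le_mul (hd : IsGraphDist d) (hK : GeodesicsFellowTravel d K) {n n' m : ℕ}
    {γ γ' : ℕ → W} (hγ : DiscreteGeodesic d n γ) (hγ' : DiscreteGeodesic d n' γ')
    (h0 : γ 0 = γ' 0) (hm : 1 ≤ m) (h : d (γ n) (γ' n') ≤ m) (i : ℕ) :
    d (γ (min i n)) (γ' (min i n')) ≤ K * m := by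
  induction m, hm using Nat.le_induction generalizing n γ with
  | base => simpa using hK n n' γ γ' hγ hγ' h0 h i
  | succ m hm ih =>
    by_cases hz : d (γ n) (γ' n') = 0
    · exact (hK n n' γ γ' hγ hγ' h0 (by omega) i).trans (Nat.le_mul_of_pos_right _ (by omega))
    obtain ⟨u, hu, hu'⟩ := hd.step _ _ hz
    obtain ⟨η, hη, e0, e1⟩ := hd.exists_discreteGeodesic (γ 0) u
    have a1 := hK _ _ γ η hγ hη e0.symm (by rw [e1]; omega) i
    have a2 := ih hη (e0.trans h0) (by rw [e1]; omega)
    have := hd.tri (γ (min i n)) (η (min i (d (γ 0) u))) (γ' (min i n'))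
    rw [mul_add]; omega

/-- Two geodesics from a common point which are within bounded distance for a long time are
uniformly close to each other at the start of that time. -/
theorem dist_le_of_long (hd : IsGraphDist d) (hK : GeodesicsFellowTravel d K) (hK1 : 1 ≤ K)
    (M : ℕ) : ∃ N, 1 ≤ N ∧ ∀ (R : ℕ) (γ γ' : ℕ → W), DiscreteGeodesic d (R + N) γ →
      DiscreteGeodesic d (R + N) γ' → γ 0 = γ' 0 → d (γ (R + N)) (γ' (R + N)) ≤ M →
      d (γ R) (γ' R) ≤ K * (2 * K) := by
  set C := K * (M + 1) with hC
  refine ⟨3 ^ (C + 1) * (C + 1), Nat.mul_pos (by positivity) (by omega), ?_⟩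
  intro R γ γ' hγ hγ' h0 hM
  set T := R + 3 ^ (C + 1) * (C + 1) with hT
  have hclose : ∀ j ≤ T, d (γ j) (γ' j) ≤ C := fun j hj => by
    have := hK.dist_le_mul hd hγ hγ' h0 (m := M + 1) (by omega) (by omega) j
    rwa [min_eq_left hj] at this
  have hlow : ∀ s t, s ≤ T → t ≤ T → t ≤ s + d (γ s) (γ' t) := fun s t hs ht => by
    have h1 := hγ 0 s (by omega) hs
    have h2 := hγ' 0 t (by omega) ht
    have := hd.tri (γ 0) (γ s) (γ' t)
    rw [h0] at *; omega
  have hup : ∀ s t, s ≤ t → t ≤ T → d (γ s) (γ' t) ≤ t - s + C := fun s t hs ht => by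
    have h1 := hγ' s t hs ht
    have h2 := hclose s (by omega)
    have := hd.tri (γ s) (γ' s) (γ' t)
    omega
  have key : ∀ j s t, R ≤ s → t = s + 3 ^ j * (C + 1) → t ≤ T →
      t - s + (C + 1) ≤ d (γ s) (γ' t) + j →
      ∃ s₀ t₁ s₁ t₀ c, R ≤ s₀ ∧ s₀ ≤ t₁ ∧ t₁ + c ≤ s₁ ∧ s₁ ≤ t₀ ∧ t₀ ≤ T ∧
        d (γ s₀) (γ' t₀) = t₀ - s₀ + c ∧ d (γ s₀) (γ' t₁) = t₁ - s₀ + c ∧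
        d (γ s₁) (γ' t₀) = t₀ - s₁ + c := by
    intro j
    induction j with
    | zero =>
      intro s t hs ht htT hc
      have := hup s t (by omega) htT
      omega
    | succ j ih =>
      intro s t hs ht htT hc
      set l := 3 ^ j * (C + 1) with hl
      have hl1 : C + 1 ≤ l := Nat.le_mul_of_pos_left _ (by positivity)
      have ht' : t = s + 3 * l := by rw [ht, hl, pow_succ]; ring
      by_cases c1 : (s + l) - s + (C + 1) ≤ d (γ s) (γ' (s + l)) + j
      · exact ih s (s + l) hs rfl (by omega) c1
      by_cases c2 : t - (s + 2 * l) + (C + 1) ≤ d (γ (s + 2 * l)) (γ' t) + j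
      · exact ih (s + 2 * l) t (by omega) (by omega) htT c2
      have a1 := hγ' (s + l) t (by omega) htT
      have a2 := hd.tri (γ s) (γ' (s + l)) (γ' t)
      have a3 := hγ s (s + 2 * l) (by omega) (by omega)
      have a4 := hd.tri (γ s) (γ (s + 2 * l)) (γ' t)
      have a5 := hlow s t (by omega) htT
      have a6 := hup s t (by omega) htT
      refine ⟨s, s + l, s + 2 * l, t, d (γ s) (γ' t) - (t - s), hs, ?_, ?_, ?_, htT, ?_, ?_, ?_⟩
        <;> omega
  have hRT := hlow R T (by omega) le_rfl
  obtain ⟨s₀, t₁, s₁, t₀, c, hR, h1, h2, h3, h4, e0, e1, e2⟩ :=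
    key (C + 1) R T le_rfl hT le_rfl (by omega)
  obtain ⟨η, hη, η0, η1⟩ := hd.exists_discreteGeodesic (γ s₁) (γ' t₀)
  obtain ⟨θ, hθ, θ0, θ1⟩ := hd.exists_discreteGeodesic (γ s₀) (γ' t₁)
  have k1 : s₀ + (s₁ - s₀) = s₁ := by omega
  have k2 : t₁ + (t₀ - t₁) = t₀ := by omega
  obtain ⟨A, hA, A0, A1⟩ := (hγ.shift (k := s₀) (m := s₁ - s₀) (by omega)).exists_append hd hη
    (by rw [η0, k1]) (by rw [η1, add_zero]; omega)
  obtain ⟨B, hB, B0, B1⟩ := hθ.exists_append hd (hγ'.shift (k := t₁) (m := t₀ - t₁) (by omega))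
    (by rw [θ1, add_zero]) (by rw [θ0, k2]; omega)
  have hb := hK _ _ _ _ hA hB (by rw [A0 _ (by omega), B0 _ (by omega), θ0, add_zero])
    (by rw [A1, B1, η1, k2, hd.self]; omega) (s₁ - s₀)
  rw [min_eq_left (by omega), min_eq_left (by omega), A0 _ le_rfl, k1,
    show s₁ - s₀ = d (γ s₀) (γ' t₁) + (s₁ - c - t₁) by omega, B1,
    show t₁ + (s₁ - c - t₁) = s₁ - c by omega] at hb
  have b1 := hγ 0 s₁ (by omega) (by omega)
  have b2 := hγ' 0 (s₁ - c) (by omega) (by omega)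
  have b3 := hd.tri (γ 0) (γ' (s₁ - c)) (γ s₁)
  have b4 := hd.symm (γ s₁) (γ' (s₁ - c))
  have b5 := hγ' (s₁ - c) s₁ (by omega) (by omega)
  have b6 := hd.tri (γ s₁) (γ' (s₁ - c)) (γ' s₁)
  rw [h0] at b1 b3
  have := hK.dist_le_mul hd (hγ.mono (m := s₁) (by omega)) (hγ'.mono (m := s₁) (by omega)) h0
    (m := 2 * K) (by omega) (by omega) R
  rwa [min_eq_left (by omega)] at this

end GeodesicsFellowTravel

/-- `x` and `y` are joined by `L` steps of length at most one outside the `r`-ball at `p`. -/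
def OutsideChain {W : Type*} (d : W → W → ℕ) (p : W) (r L : ℕ) (x y : W) : Prop :=
  ∃ c : ℕ → W, c 0 = x ∧ c L = y ∧ (∀ i < L, d (c i) (c (i + 1)) ≤ 1) ∧ ∀ i ≤ L, r ≤ d p (c i)

namespace OutsideChain

variable {W : Type*} {d : W → W → ℕ} {p x y z : W} {r L L' : ℕ}

theorem left (h : OutsideChain d p r L x y) : r ≤ d p x := by
  obtain ⟨c, rfl, -, -, h⟩ := h
  exact h 0 (Nat.zero_le _)

theorem right (h : OutsideChain d p r L x y) : r ≤ d p y := by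
  obtain ⟨c, -, rfl, -, h⟩ := h
  exact h L le_rfl

theorem mono_radius {r' : ℕ} (h : OutsideChain d p r L x y) (hr : r' ≤ r) :
    OutsideChain d p r' L x y := by
  obtain ⟨c, h0, h1, h2, h3⟩ := h
  exact ⟨c, h0, h1, h2, fun i hi => hr.trans (h3 i hi)⟩

theorem mono_length (hd : IsGraphDist d) (h : OutsideChain d p r L x y) (hL : L ≤ L') :
    OutsideChain d p r L' x y := by
  obtain ⟨c, h0, h1, h2, h3⟩ := h
  refine ⟨fun i => c (min i L), by simpa using h0, by simpa [hL] using h1, fun i _ => ?_,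
    fun i _ => h3 _ (min_le_right _ _)⟩
  rcases lt_or_ge i L with hi | hi
  · simpa [hi.le, Nat.succ_le_of_lt hi] using h2 i hi
  · simp [hi, hi.trans (Nat.le_succ i), hd.self]

theorem symm (hd : IsGraphDist d) (h : OutsideChain d p r L x y) : OutsideChain d p r L y x := by
  obtain ⟨c, h0, h1, h2, h3⟩ := h
  refine ⟨fun i => c (L - i), by simpa using h1, by simpa using h0, fun i hi => ?_,
    fun i _ => h3 _ (Nat.sub_le _ _)⟩
  have := h2 (L - (i + 1)) (by omega)
  rw [show L - (i + 1) + 1 = L - i by omega, hd.symm] at this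
  exact this

theorem trans (h : OutsideChain d p r L x y) (h' : OutsideChain d p r L' y z) :
    OutsideChain d p r (L + L') x z := by
  obtain ⟨c, h0, h1, h2, h3⟩ := h
  obtain ⟨e, e0, e1, e2, e3⟩ := h'
  have hlt : ∀ i ≤ L, (fun i => if i < L then c i else e (i - L)) i = c i := fun i hi => by
    simp only
    split_ifs with h
    · rfl
    · obtain rfl : i = L := by omega
      rw [Nat.sub_self, e0, h1]
  have hge : ∀ i, (fun i => if i < L then c i else e (i - L)) (L + i) = e i := fun i => by simp
  refine ⟨fun i => if i < L then c i else e (i - L), ?_, ?_, fun i hi => ?_, fun i hi => ?_⟩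
  · exact (hlt 0 (Nat.zero_le _)).trans h0
  · exact (hge L').trans e1
  · rcases lt_or_ge i L with h | h
    · rw [hlt i h.le, hlt (i + 1) h]
      exact h2 i h
    · obtain ⟨m, rfl⟩ := Nat.exists_eq_add_of_le h
      rw [hge m, add_assoc, hge (m + 1)]
      exact e2 m (by omega)
  · rcases lt_or_ge i L with h | h
    · rw [hlt i h.le]
      exact h3 i h.le
    · obtain ⟨m, rfl⟩ := Nat.exists_eq_add_of_le h
      rw [hge m]
      exact e3 m (by omega)

theorem exists_split (h : OutsideChain d p r (L + L') x z) :
    ∃ y, OutsideChain d p r L x y ∧ OutsideChain d p r L' y z := by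
  obtain ⟨c, h0, h1, h2, h3⟩ := h
  exact ⟨c L, ⟨c, h0, rfl, fun i hi => h2 i (by omega), fun i hi => h3 i (by omega)⟩,
    fun i => c (L + i), rfl, h1, fun i hi => h2 (L + i) (by omega),
    fun i hi => h3 (L + i) (by omega)⟩

theorem of_discreteGeodesic {n i j : ℕ} {γ : ℕ → W} (hγ : DiscreteGeodesic d n γ) (hij : i ≤ j)
    (hj : j ≤ n) (h : ∀ t, i ≤ t → t ≤ j → r ≤ d p (γ t)) :
    OutsideChain d p r (j - i) (γ i) (γ j) := by
  refine ⟨fun t => γ (i + t), rfl, by simp only; congr 1; omega, fun t ht => ?_,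
    fun t ht => h _ (by omega) (by omega)⟩
  rw [hγ (i + t) (i + (t + 1)) (by omega) (by omega)]
  omega

theorem of_discreteGeodesic_of_dist_le (hd : IsGraphDist d) {n i j : ℕ} {γ : ℕ → W}
    (hγ : DiscreteGeodesic d n γ) (hi : i ≤ n) (hj : j ≤ n) (h : ∀ t ≤ n, r ≤ d p (γ t))
    (hL : d (γ i) (γ j) ≤ L) : OutsideChain d p r L (γ i) (γ j) := by
  rcases le_total i j with hij | hij
  · rw [hγ i j hij hj] at hL
    exact (of_discreteGeodesic hγ hij hj fun t _ ht => h t (ht.trans hj)).mono_length hd hL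
  · rw [hd.symm, hγ j i hij hi] at hL
    exact ((of_discreteGeodesic hγ hij hi fun t _ ht => h t (ht.trans hi)).mono_length hd hL).symm
      hd

theorem of_dist_le (hd : IsGraphDist d) (hL : d x y ≤ L) (hr : r + L ≤ d p x) :
    OutsideChain d p r L x y := by
  obtain ⟨γ, hγ, h0, h1⟩ := hd.exists_discreteGeodesic x y
  have := of_discreteGeodesic_of_dist_le hd hγ (Nat.zero_le _) le_rfl (r := r) (p := p) (L := L)
    (fun t ht => ?_) (by rwa [h0, h1])
  · rwa [h0, h1] at this
  · have a1 := hγ 0 t (Nat.zero_le _) ht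
    have a2 := hd.tri p (γ t) (γ 0)
    rw [hd.symm (γ t)] at a2
    rw [h0] at a1 a2
    omega

end OutsideChain

namespace GeodesicsFellowTravel

variable {W : Type*} {d : W → W → ℕ} {K : ℕ}

/-- Geodesics whose far ends are joined by a chain of length `2 ^ k` outside a ball of radius
`R + k * N` are close to each other at time `R`. -/
theorem dist_le_of_outsideChain (hd : IsGraphDist d) (hK : GeodesicsFellowTravel d K)
    {D N : ℕ} (hD : K ≤ D)
    (hN : ∀ (R : ℕ) (γ γ' : ℕ → W), DiscreteGeodesic d (R + N) γ →
      DiscreteGeodesic d (R + N) γ' → γ 0 = γ' 0 → d (γ (R + N)) (γ' (R + N)) ≤ 2 * D →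
      d (γ R) (γ' R) ≤ D)
    (k R n n' : ℕ) {γ γ' : ℕ → W} (hγ : DiscreteGeodesic d n γ) (hγ' : DiscreteGeodesic d n' γ')
    (h0 : γ 0 = γ' 0) (h : OutsideChain d (γ 0) (R + k * N) (2 ^ k) (γ n) (γ' n')) :
    d (γ R) (γ' R) ≤ D := by
  induction k generalizing R n n' γ γ' with
  | zero =>
    have h1 := h.left
    have h2 := h.right
    rw [hγ 0 n (Nat.zero_le _) le_rfl] at h1
    rw [h0, hγ' 0 n' (Nat.zero_le _) le_rfl] at h2
    obtain ⟨c, c0, c1, c2, -⟩ := h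
    have h3 := c2 0 (by simp)
    simp only [pow_zero] at c1
    rw [c0, zero_add, c1] at h3
    have := hK n n' γ γ' hγ hγ' h0 h3 R
    rw [min_eq_left (by omega), min_eq_left (by omega)] at this
    omega
  | succ k ih =>
    have h1 := h.left
    have h2 := h.right
    rw [hγ 0 n (Nat.zero_le _) le_rfl] at h1
    rw [h0, hγ' 0 n' (Nat.zero_le _) le_rfl] at h2
    rw [pow_succ, mul_two, show R + (k + 1) * N = (R + N) + k * N by ring] at h
    rw [show R + (k + 1) * N = (R + N) + k * N by ring] at h1 h2
    obtain ⟨y, hy, hy'⟩ := h.exists_split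
    obtain ⟨η, hη, e0, e1⟩ := hd.exists_discreteGeodesic (γ 0) y
    have a1 := ih (R + N) _ _ hγ hη e0.symm (by rwa [e1])
    have a2 := ih (R + N) _ _ hη hγ' (e0.trans h0) (by rwa [e1, e0])
    refine hN R γ γ' (hγ.mono (by omega)) (hγ'.mono (by omega)) h0 ?_
    have := hd.tri (γ (R + N)) (η (R + N)) (γ' (R + N))
    omega

/-- Points at distance at most `m` on two sides issuing from a common point, both of which avoid
a ball, are joined by a chain avoiding a slightly smaller ball. -/
theorem outsideChain_of_sides (hd : IsGraphDist d) (hK : GeodesicsFellowTravel d K)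
    {D N : ℕ} (hD : K ≤ D)
    (hN : ∀ (R : ℕ) (γ γ' : ℕ → W), DiscreteGeodesic d (R + N) γ →
      DiscreteGeodesic d (R + N) γ' → γ 0 = γ' 0 → d (γ (R + N)) (γ' (R + N)) ≤ 2 * D →
      d (γ R) (γ' R) ≤ D)
    {k m r a b j j' : ℕ} {α β : ℕ → W} {p : W} (hα : DiscreteGeodesic d a α)
    (hβ : DiscreteGeodesic d b β) (h0 : α 0 = β 0) (hrα : ∀ t ≤ a, r ≤ d p (α t))
    (hrβ : ∀ t ≤ b, r ≤ d p (β t)) (hDr : D ≤ r) (hj : j ≤ a) (hj' : j' ≤ b)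
    (hm : d (α j) (β j') ≤ m) (hmk : m ≤ 2 ^ k) :
    OutsideChain d p (r - D) (3 * m + 2 * (k * N) + D) (α j) (β j') := by
  have a1 := hα 0 j (Nat.zero_le _) hj
  have a2 := hβ 0 j' (Nat.zero_le _) hj'
  have a3 := hd.tri (α 0) (α j) (β j')
  have a4 := hd.tri (α 0) (β j') (α j)
  rw [hd.symm (β j')] at a4
  rw [← h0] at a2
  set R := j - (m + k * N) with hR
  have hclose : d (α R) (β R) ≤ D := by
    rcases Nat.eq_zero_or_pos R with hz | hz
    · rw [hz, h0, hd.self]; exact Nat.zero_le _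
    · exact hK.dist_le_of_outsideChain hd hD hN k R j j' (hα.mono hj) (hβ.mono hj') h0
        ((OutsideChain.of_dist_le hd hm (by omega)).mono_length hd hmk)
  have c1 : OutsideChain d p (r - D) (m + k * N) (α j) (α R) :=
    (OutsideChain.of_discreteGeodesic_of_dist_le hd hα hj (by omega) hrα
      (by rw [hd.symm, hα R j (by omega) hj]; omega)).mono_radius (Nat.sub_le _ _)
  have c2 : OutsideChain d p (r - D) D (α R) (β R) :=
    OutsideChain.of_dist_le hd hclose (by have := hrα R (by omega); omega)
  have c3 : OutsideChain d p (r - D) (2 * m + k * N) (β R) (β j') :=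
    (OutsideChain.of_discreteGeodesic_of_dist_le hd hβ (by omega) hj' hrβ
      (by rw [hβ R j' (by omega) hj']; omega)).mono_radius (Nat.sub_le _ _)
  exact ((c1.trans c2).trans c3).mono_length hd (by omega)

end GeodesicsFellowTravel

theorem exists_linear_le_two_pow (A B : ℕ) : ∃ k₀, ∀ k ≥ k₀, A + B * k ≤ 2 ^ k := by
  refine ⟨max 4 (A + B), fun k hk => ?_⟩
  have h4 : 4 ≤ k := (le_max_left _ _).trans hk
  have hAB : A + B ≤ k := (le_max_right _ _).trans hk
  have hsq : k * k ≤ 2 ^ k := by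
    clear hk hAB
    induction k, h4 using Nat.le_induction with
    | base => norm_num
    | succ k hk ih => rw [pow_succ]; nlinarith
  nlinarith

namespace GeodesicsFellowTravel

variable {W : Type*} {d : W → W → ℕ} {K : ℕ}

theorem thin_triangles (hd : IsGraphDist d) (hK : GeodesicsFellowTravel d K) (hK1 : 1 ≤ K) :
    ∃ δ, ∀ (n a b : ℕ) (σ α β : ℕ → W), DiscreteGeodesic d n σ → DiscreteGeodesic d a α →
      DiscreteGeodesic d b β → σ 0 = α a → σ n = β b → α 0 = β 0 →
      ∀ i ≤ n, ∃ j, (j ≤ a ∧ d (σ i) (α j) ≤ δ) ∨ (j ≤ b ∧ d (σ i) (β j) ≤ δ) := by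
  set D := K * (2 * K) with hDdef
  have hKD : K ≤ D := by nlinarith
  obtain ⟨N, hN1, hN⟩ := hK.dist_le_of_long hd hK1 (2 * D)
  rw [← hDdef] at hN
  obtain ⟨k₀, hk₀⟩ := exists_linear_le_two_pow (44 * D + 22 * N + D) (22 * N)
  refine ⟨2 * D + k₀ * N, fun n a b σ α β hσ hα hβ ha hb h0 => ?_⟩
  set P : ℕ → Prop := fun r =>
    ∀ i ≤ n, ∃ j, (j ≤ a ∧ d (σ i) (α j) ≤ r) ∨ (j ≤ b ∧ d (σ i) (β j) ≤ r) with hP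
  have hmono : ∀ r r', r ≤ r' → P r → P r' := fun r r' hr h i hi => by
    obtain ⟨j, hj⟩ := h i hi
    exact ⟨j, hj.imp (fun h => ⟨h.1, h.2.trans hr⟩) (fun h => ⟨h.1, h.2.trans hr⟩)⟩
  by_contra hcon
  change ¬ P _ at hcon
  have hex : ∃ r, P r := ⟨n, fun i hi => ⟨a, Or.inl ⟨le_rfl, by
    rw [← ha, hd.symm, hσ 0 i (Nat.zero_le _) hi]; omega⟩⟩⟩
  classical
  obtain ⟨r, hr, hmin⟩ : ∃ r, P r ∧ ∀ r' < r, ¬ P r' :=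
    ⟨Nat.find hex, Nat.find_spec hex, fun r' h => Nat.find_min hex h⟩
  have hrbig : 2 * D + k₀ * N < r := by
    by_contra h
    exact hcon (hmono r _ (by omega) hr)
  have hnot := hmin (r - 1) (by omega)
  simp only [hP] at hnot
  push Not at hnot
  obtain ⟨i₀, hi₀, hfar⟩ := hnot
  have hrα : ∀ t ≤ a, r ≤ d (σ i₀) (α t) := fun t ht => by have := (hfar t).1 ht; omega
  have hrβ : ∀ t ≤ b, r ≤ d (σ i₀) (β t) := fun t ht => by have := (hfar t).2 ht; omega
  set k := (r - 2 * D) / N with hk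
  have hk1 : k * N ≤ r - 2 * D := Nat.div_mul_le_self _ _
  have hk2 : r - 2 * D < (k + 1) * N :=
    (Nat.div_lt_iff_lt_mul hN1).1 (Nat.lt_succ_self _)
  have hk3 : k₀ ≤ k := (Nat.le_div_iff_mul_le hN1).2 (by omega)
  have hk4 := hk₀ k hk3
  have hk5 : r ≤ 2 * D + k * N + N := by rw [add_mul] at hk2; omega
  have hlen : 22 * r + D ≤ 2 ^ k := by linarith
  have endpt : ∀ i ≤ n, (i + 2 * r = i₀ ∨ i₀ + 2 * r = i ∨ ((i = 0 ∨ i = n) ∧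
      i ≤ i₀ + 2 * r ∧ i₀ ≤ i + 2 * r)) →
      ∃ j, (j ≤ a ∧ OutsideChain d (σ i₀) r r (σ i) (α j) ∧ d (σ i₀) (α j) ≤ 3 * r) ∨
        (j ≤ b ∧ OutsideChain d (σ i₀) r r (σ i) (β j) ∧ d (σ i₀) (β j) ≤ 3 * r) := by
    intro i hi hcase
    have hdist : d (σ i₀) (σ i) = (i₀ - i) + (i - i₀) := by
      rcases le_total i i₀ with h | h
      · rw [hd.symm, hσ i i₀ h hi₀]; omega
      · rw [hσ i₀ i h hi]; omega
    have far : d (σ i₀) (σ i) = 2 * r → ∀ s, d (σ i) s ≤ r →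
        OutsideChain d (σ i₀) r r (σ i) s ∧ d (σ i₀) s ≤ 3 * r := fun h s hs =>
      ⟨OutsideChain.of_dist_le hd hs (by omega), by
        have := hd.tri (σ i₀) (σ i) s
        omega⟩
    have far' : d (σ i₀) (σ i) = 2 * r →
        ∃ j, (j ≤ a ∧ OutsideChain d (σ i₀) r r (σ i) (α j) ∧ d (σ i₀) (α j) ≤ 3 * r) ∨
        (j ≤ b ∧ OutsideChain d (σ i₀) r r (σ i) (β j) ∧ d (σ i₀) (β j) ≤ 3 * r) := fun h => by
      obtain ⟨j, hj⟩ := hr i hi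
      exact ⟨j, hj.imp (fun h' => ⟨h'.1, far h _ h'.2⟩) (fun h' => ⟨h'.1, far h _ h'.2⟩)⟩
    have near : ∀ s, σ i = s → r ≤ d (σ i₀) s → d (σ i₀) (σ i) ≤ 2 * r →
        OutsideChain d (σ i₀) r r (σ i) s ∧ d (σ i₀) s ≤ 3 * r := fun s hs hrs h => by
      subst hs
      exact ⟨OutsideChain.of_dist_le hd (L := 0) (by rw [hd.self]) (by omega) |>.mono_length hd
        (Nat.zero_le _), by omega⟩
    rcases hcase with h | h | ⟨rfl | rfl, h1, h2⟩
    · exact far' (by clear far' near; omega)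
    · exact far' (by clear far' near; omega)
    · exact ⟨a, Or.inl ⟨le_rfl, near _ ha (hrα a le_rfl) (by omega)⟩⟩
    · exact ⟨b, Or.inr ⟨le_rfl, near _ hb (hrβ b le_rfl) (by omega)⟩⟩
  have h6 : ∀ s s', d (σ i₀) s ≤ 3 * r → d (σ i₀) s' ≤ 3 * r → d s s' ≤ 6 * r :=
    fun s s' h h' => by
    have := hd.tri s (σ i₀) s'
    rw [hd.symm s (σ i₀)] at this
    omega
  set iL := i₀ - 2 * r with hiL
  set iR := min (i₀ + 2 * r) n with hiR
  have main : OutsideChain d (σ i₀) (r - D) (2 ^ k) (σ iL) (σ iR) := by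
    obtain ⟨j, hj⟩ := endpt iL (by omega) (by omega)
    obtain ⟨j', hj'⟩ := endpt iR (by omega) (by omega)
    have conc : ∀ s s', OutsideChain d (σ i₀) r r (σ iL) s → OutsideChain d (σ i₀) r r (σ iR) s' →
        OutsideChain d (σ i₀) (r - D) (3 * (6 * r) + 2 * (k * N) + D) s s' →
        OutsideChain d (σ i₀) (r - D) (2 ^ k) (σ iL) (σ iR) := fun s s' h h' h'' =>
      (((h.mono_radius (Nat.sub_le _ _)).trans h'').trans
        ((h'.symm hd).mono_radius (Nat.sub_le _ _))).mono_length hd (by omega)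
    rcases hj with ⟨hj, c, e⟩ | ⟨hj, c, e⟩ <;> rcases hj' with ⟨hj', c', e'⟩ | ⟨hj', c', e'⟩
    · exact conc _ _ c c' (((OutsideChain.of_discreteGeodesic_of_dist_le hd hα hj hj' hrα
        (h6 _ _ e e')).mono_radius (Nat.sub_le _ _)).mono_length hd (by omega))
    · exact conc _ _ c c' (hK.outsideChain_of_sides hd hKD hN hα hβ h0 hrα hrβ (by omega) hj hj'
        (h6 _ _ e e') (by omega))
    · exact conc _ _ c c' ((hK.outsideChain_of_sides hd hKD hN hα hβ h0 hrα hrβ (by omega) hj' hj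
        (h6 _ _ e' e) (by omega)).symm hd)
    · exact conc _ _ c c' (((OutsideChain.of_discreteGeodesic_of_dist_le hd hβ hj hj' hrβ
        (h6 _ _ e e')).mono_radius (Nat.sub_le _ _)).mono_length hd (by omega))
  have g1 := hσ.reverse hd (k := i₀) (m := i₀ - iL) hi₀ (Nat.sub_le _ _)
  have g2 := hσ.shift (k := i₀) (m := iR - i₀) (by omega)
  have l1 := main.left
  have l2 := main.right
  rw [hd.symm, hσ iL i₀ (by omega) hi₀] at l1
  rw [hσ i₀ iR (by omega) (by omega)] at l2
  have := hK.dist_le_of_outsideChain hd hKD hN k D _ _ g1 g2 (by simp) (by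
    simp only [Nat.sub_zero]
    rw [show i₀ - (i₀ - iL) = iL by omega, show i₀ + (iR - i₀) = iR by omega]
    exact main.mono_radius (by omega))
  rw [hσ (i₀ - D) (i₀ + D) (by omega) (by omega)] at this
  have : 1 ≤ D := hK1.trans hKD
  omega

/-- If the concatenation of `α` and `σ` is a geodesic up to an additive error `e`, then its corner
is close to any geodesic joining its endpoints. -/
theorem exists_dist_corner_le (hd : IsGraphDist d) (hK : GeodesicsFellowTravel d K) (e : ℕ) :
    ∃ B, ∀ (a n m : ℕ) (α σ τ : ℕ → W), DiscreteGeodesic d a α → DiscreteGeodesic d n σ →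
      DiscreteGeodesic d m τ → α 0 = τ 0 → α a = σ 0 → σ n = τ m → a + n ≤ m + e →
      d (α a) (τ (min a m)) ≤ B := by
  induction e with
  | zero =>
    refine ⟨K, fun a n m α σ τ hα hσ hτ h0 h1 h2 hle => ?_⟩
    have hm := hτ 0 m (Nat.zero_le _) le_rfl
    obtain ⟨θ, hθ, θ0, θ1⟩ := hα.exists_append hd hσ h1 (by rw [h0, h2]; omega)
    have := hK _ _ _ _ hθ hτ (by rw [θ0 0 (Nat.zero_le _), h0])
      (by rw [θ1, h2, hd.self]; omega) a
    rwa [min_eq_left (Nat.le_add_right _ _), θ0 a le_rfl] at this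
  | succ e ih =>
    obtain ⟨B, hB⟩ := ih
    refine ⟨B + K + (e + 1) + K, fun a n m α σ τ hα hσ hτ h0 h1 h2 hle => ?_⟩
    by_cases hlt : a + n ≤ m + e
    · exact (hB a n m α σ τ hα hσ hτ h0 h1 h2 hlt).trans (by omega)
    have hm := hτ 0 m (Nat.zero_le _) le_rfl
    have ha := hα 0 a (Nat.zero_le _) le_rfl
    have hex : ∃ i, d (α 0) (σ i) + e + 1 ≤ a + i := ⟨n, by rw [h0, h2, hm]; omega⟩
    classical
    obtain ⟨i', hi', hmin⟩ : ∃ i', d (α 0) (σ i') + e + 1 ≤ a + i' ∧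
        ∀ i < i', ¬ d (α 0) (σ i) + e + 1 ≤ a + i :=
      ⟨Nat.find hex, Nat.find_spec hex, fun i h => Nat.find_min hex h⟩
    have hi'n : i' ≤ n := by
      by_contra h
      exact hmin n (by omega) (by rw [h0, h2, hm]; omega)
    obtain ⟨i, rfl⟩ : ∃ i, i' = i + 1 := ⟨i' - 1, by
      have : i' ≠ 0 := by
        rintro rfl
        rw [← h1] at hi'
        omega
      omega⟩
    have hi := hmin i (Nat.lt_succ_self _)
    obtain ⟨η₁, hη₁, e0, e1⟩ := hd.exists_discreteGeodesic (α 0) (σ i)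
    obtain ⟨η₂, hη₂, f0, f1⟩ := hd.exists_discreteGeodesic (α 0) (σ (i + 1))
    have b1 := hB _ _ _ α σ η₁ hα (hσ.mono (m := i) (by omega)) hη₁ e0.symm h1 e1.symm (by omega)
    have b2 := hσ i (i + 1) (by omega) hi'n
    have b3 := hK _ _ η₁ η₂ hη₁ hη₂ (e0.trans f0.symm) (by rw [e1, f1, b2]; omega) a
    have b4 := hd.tri (α 0) (σ (i + 1)) (σ i)
    rw [hd.symm (σ (i + 1)), b2] at b4
    obtain ⟨θ, hθ, θ0, θ1⟩ := hη₂.exists_append hd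
      (hσ.shift (k := i + 1) (m := n - (i + 1)) (by omega)) f1 (by
        rw [f0, show i + 1 + (n - (i + 1)) = n by omega, h0, h2, hm, ← h0]; omega)
    have b5 := hK _ _ θ τ hθ hτ (by rw [θ0 0 (Nat.zero_le _), f0, h0])
      (by rw [θ1, show i + 1 + (n - (i + 1)) = n by omega, h2, hd.self]; omega) a
    have b6 := hθ (min a (d (α 0) (σ (i + 1))))
      (min a (d (α 0) (σ (i + 1)) + (n - (i + 1)))) (by omega) (by omega)
    rw [θ0 _ (by omega)] at b6
    have t1 := hd.tri (α a) (η₁ (min a (d (α 0) (σ i)))) (τ (min a m))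
    have t2 := hd.tri (η₁ (min a (d (α 0) (σ i)))) (η₂ (min a (d (α 0) (σ (i + 1))))) (τ (min a m))
    have t3 := hd.tri (η₂ (min a (d (α 0) (σ (i + 1)))))
      (θ (min a (d (α 0) (σ (i + 1)) + (n - (i + 1))))) (τ (min a m))
    omega

end GeodesicsFellowTravel

namespace IsGeodesicSegment

variable {X : Type*} [MetricSpace X]

theorem shift {L u M : ℝ} {σ : ℝ → X} (h : IsGeodesicSegment L σ) (hu : 0 ≤ u) (hM : 0 ≤ M)
    (huM : u + M ≤ L) : IsGeodesicSegment M (fun t => σ (u + t)) := by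
  refine ⟨hM, fun s hs t ht => ?_⟩
  rw [h.2 (u + s) ⟨by linarith [hs.1], by linarith [hs.2]⟩ (u + t)
    ⟨by linarith [ht.1], by linarith [ht.2]⟩]
  congr 1; ring

theorem mono {L M : ℝ} {σ : ℝ → X} (h : IsGeodesicSegment L σ) (hM : 0 ≤ M) (hML : M ≤ L) :
    IsGeodesicSegment M σ := by
  simpa using h.shift le_rfl hM (by linarith)

theorem reverse {L : ℝ} {σ : ℝ → X} (h : IsGeodesicSegment L σ) :
    IsGeodesicSegment L (fun t => σ (L - t)) := by
  refine ⟨h.1, fun s hs t ht => ?_⟩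
  rw [h.2 (L - s) ⟨by linarith [hs.2], by linarith [hs.1]⟩ (L - t)
    ⟨by linarith [ht.2], by linarith [ht.1]⟩, abs_sub_comm]
  congr 1; ring

theorem dist_eq {L s t : ℝ} {σ : ℝ → X} (h : IsGeodesicSegment L σ) (hs : 0 ≤ s) (hst : s ≤ t)
    (ht : t ≤ L) : dist (σ s) (σ t) = t - s := by
  rw [h.2 s ⟨hs, hst.trans ht⟩ t ⟨hs.trans hst, ht⟩, abs_sub_comm, abs_of_nonneg (by linarith)]

/-- Two geodesic segments whose lengths add up to the distance between the far ends concatenate. -/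
theorem exists_append {L M : ℝ} {σ τ : ℝ → X} (hσ : IsGeodesicSegment L σ)
    (hτ : IsGeodesicSegment M τ) (h : σ L = τ 0) (hl : L + M ≤ dist (σ 0) (τ M)) :
    ∃ θ : ℝ → X, IsGeodesicSegment (L + M) θ ∧ (∀ t ≤ L, θ t = σ t) ∧
      ∀ t, 0 ≤ t → θ (L + t) = τ t := by
  have hlt : ∀ t ≤ L, (fun t => if t ≤ L then σ t else τ (t - L)) t = σ t := fun t ht => if_pos ht
  have hge : ∀ t, 0 ≤ t → (fun t => if t ≤ L then σ t else τ (t - L)) (L + t) = τ t :=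
    fun t ht => by
    rcases ht.eq_or_lt with rfl | ht'
    · simp [h]
    · have : ¬ L + t ≤ L := by linarith
      simp [this]
  refine ⟨_, ⟨add_nonneg hσ.1 hτ.1, ?_⟩, hlt, hge⟩
  have key : ∀ s t, 0 ≤ s → s ≤ t → t ≤ L + M →
      dist ((fun t => if t ≤ L then σ t else τ (t - L)) s)
        ((fun t => if t ≤ L then σ t else τ (t - L)) t) = t - s := by
    intro s t hs hst ht
    by_cases htL : t ≤ L
    · rw [hlt s (hst.trans htL), hlt t htL, hσ.dist_eq hs hst htL]
    obtain ⟨t, rfl⟩ : ∃ t', t = L + t' := ⟨t - L, by ring⟩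
    have ht0 : 0 ≤ t := by linarith
    have ht1 : t ≤ M := by linarith
    rw [hge t ht0]
    by_cases hsL : s ≤ L
    · rw [hlt s hsL]
      have h1 := hσ.dist_eq hs hsL le_rfl
      have h2 := hτ.dist_eq le_rfl ht0 ht1
      have h3 := hτ.dist_eq ht0 ht1 le_rfl
      have h4 := hσ.dist_eq le_rfl hs hsL
      have h5 := dist_triangle (σ s) (σ L) (τ t)
      have h6 := dist_triangle4 (σ 0) (σ s) (τ t) (τ M)
      rw [h] at h1 h5
      linarith
    · obtain ⟨s, rfl⟩ : ∃ s', s = L + s' := ⟨s - L, by ring⟩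
      rw [hge s (by linarith), hτ.dist_eq (by linarith) (by linarith) ht1]
      ring
  intro s hs t ht
  rcases le_total s t with hst | hst
  · rw [key s t hs.1 hst ht.2, abs_sub_comm, abs_of_nonneg (by linarith)]
  · rw [dist_comm, key t s ht.1 hst hs.2, abs_of_nonneg (by linarith)]

end IsGeodesicSegment

section VertexNet

variable {X : Type*} [MetricSpace X] {V : Set X} {d : V → V → ℕ}

theorem isGraphDist_of_net (hgeo : IsGeodesicSpace X) (hnet : ∀ x : X, ∃ v : V, dist x v ≤ 1 / 2)
    (hd : ∀ v w : V, dist (v : X) w = d v w) : IsGraphDist d where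
  self v := by
    have := hd v v
    rw [dist_self] at this
    exact_mod_cast this.symm
  eq_of_zero v w h := by
    have := hd v w
    rw [h, Nat.cast_zero, dist_eq_zero] at this
    exact Subtype.ext this
  symm v w := by
    have := hd v w
    rw [dist_comm, hd] at this
    exact_mod_cast this.symm
  tri u v w := by
    have := dist_triangle (u : X) v w
    simp only [hd] at this
    exact_mod_cast this
  step v w h := by
    obtain ⟨σ, hσ, h0, h1⟩ := hgeo v w
    have hL : (1 : ℝ) ≤ dist (v : X) w := by
      rw [hd]
      exact_mod_cast Nat.one_le_iff_ne_zero.2 h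
    obtain ⟨u, hu⟩ := hnet (σ (3 / 4))
    have a1 := hσ.dist_eq (s := 0) (t := 3 / 4) le_rfl (by norm_num) (by linarith)
    have a2 := hσ.dist_eq (s := 3 / 4) (t := dist (v : X) w) (by norm_num) (by linarith) le_rfl
    have a3 := dist_triangle (v : X) (σ (3 / 4)) u
    have a4 := dist_triangle_left (u : X) w (σ (3 / 4))
    have a5 := dist_triangle (v : X) u w
    rw [h0] at a1
    rw [h1] at a2
    simp only [hd] at a2 a3 a4 a5
    have b1 : (d v u : ℝ) < 2 := by linarith
    have b2 : (d u w : ℝ) < d v w := by linarith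
    norm_cast at b1 b2 a5
    exact ⟨u, by omega, by omega⟩

/-- A discrete geodesic of vertices extends to a geodesic segment. -/
theorem DiscreteGeodesic.exists_segment (hgeo : IsGeodesicSpace X)
    (hd : ∀ v w : V, dist (v : X) w = d v w) {n : ℕ} {γ : ℕ → V} (hγ : DiscreteGeodesic d n γ) :
    ∃ σ : ℝ → X, IsGeodesicSegment n σ ∧ ∀ i ≤ n, σ i = γ i := by
  induction n with
  | zero =>
    refine ⟨fun _ => γ 0, ⟨by simp, fun s hs t ht => ?_⟩, fun i hi => ?_⟩
    · simp only [Nat.cast_zero, Set.Icc_self, Set.mem_singleton_iff] at hs ht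
      simp [hs, ht]
    · obtain rfl : i = 0 := by omega
      rfl
  | succ n ih =>
    obtain ⟨σ, hσ, hs⟩ := ih (hγ.mono (Nat.le_succ n))
    obtain ⟨τ, hτ, t0, t1⟩ := hgeo (γ n) (γ (n + 1))
    have h1 := hd (γ n) (γ (n + 1))
    rw [hγ n (n + 1) (by omega) le_rfl, Nat.add_sub_cancel_left, Nat.cast_one] at h1
    rw [h1] at hτ t1
    have hs0 := hs 0 (Nat.zero_le _)
    rw [Nat.cast_zero] at hs0
    obtain ⟨θ, hθ, θ0, θ1⟩ := hσ.exists_append hτ (by rw [t0, hs n le_rfl]) (by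
      rw [t1, hs0, hd, hγ 0 (n + 1) (by omega) le_rfl]; simp)
    refine ⟨θ, by exact_mod_cast hθ, fun i hi => ?_⟩
    rcases Nat.lt_or_ge n i with h | h
    · obtain rfl : i = n + 1 := by omega
      rw [Nat.cast_succ, θ1 1 zero_le_one, t1]
    · rw [θ0 i (by exact_mod_cast h), hs i h]

theorem dist_le_of_bigon {K : ℝ}
    (hbigon : ∀ (L : ℝ) (σ σ' : ℝ → X), IsGeodesicSegment L σ → IsGeodesicSegment L σ' →
      σ 0 = σ' 0 → σ L = σ' L →
      ∀ s ∈ Set.Icc (0 : ℝ) L, ∃ t ∈ Set.Icc (0 : ℝ) L, dist (σ s) (σ' t) ≤ K)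
    {L s : ℝ} {σ σ' : ℝ → X} (hσ : IsGeodesicSegment L σ) (hσ' : IsGeodesicSegment L σ')
    (h0 : σ 0 = σ' 0) (h1 : σ L = σ' L) (hs : 0 ≤ s) (hsL : s ≤ L) :
    dist (σ s) (σ' s) ≤ 2 * K := by
  obtain ⟨t, ht, h⟩ := hbigon L σ σ' hσ hσ' h0 h1 s ⟨hs, hsL⟩
  have a1 := hσ.dist_eq le_rfl hs hsL
  have a2 := hσ'.dist_eq le_rfl ht.1 ht.2
  have a3 := hσ'.2 t ht s ⟨hs, hsL⟩
  have a4 := abs_dist_sub_le (σ s) (σ' t) (σ' 0)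
  rw [← h0, dist_comm (σ s), a1, dist_comm (σ' t), h0, a2, sub_zero, sub_zero, abs_sub_comm] at a4
  have := dist_triangle (σ s) (σ' t) (σ' s)
  linarith

/-- If bigons are uniformly thin then discrete geodesics of vertices fellow travel. -/
theorem geodesicsFellowTravel_of_bigon (hgeo : IsGeodesicSpace X)
    (hnet : ∀ x : X, ∃ v : V, dist x v ≤ 1 / 2) (hd : ∀ v w : V, dist (v : X) w = d v w) {C : ℕ}
    (hC : ∀ (L s : ℝ) (σ σ' : ℝ → X), IsGeodesicSegment L σ → IsGeodesicSegment L σ' →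
      σ 0 = σ' 0 → σ L = σ' L → 0 ≤ s → s ≤ L → dist (σ s) (σ' s) ≤ C) :
    GeodesicsFellowTravel d (2 * C + 1) := by
  have hG := isGraphDist_of_net hgeo hnet hd
  have bigon : ∀ (n : ℕ) (γ γ' : ℕ → V), DiscreteGeodesic d n γ → DiscreteGeodesic d n γ' →
      γ 0 = γ' 0 → γ n = γ' n → ∀ i ≤ n, d (γ i) (γ' i) ≤ C := by
    intro n γ γ' hγ hγ' h0 h1 i hi
    obtain ⟨σ, hσ, hs⟩ := hγ.exists_segment hgeo hd
    obtain ⟨σ', hσ', hs'⟩ := hγ'.exists_segment hgeo hd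
    have hs0 := hs 0 (Nat.zero_le _)
    have hs0' := hs' 0 (Nat.zero_le _)
    rw [Nat.cast_zero] at hs0 hs0'
    have := hC n i σ σ' hσ hσ' (by rw [hs0, hs0', h0])
      (by rw [hs n le_rfl, hs' n le_rfl, h1]) (by positivity) (by exact_mod_cast hi)
    rw [hs i hi, hs' i hi, hd] at this
    exact_mod_cast this
  have succ : ∀ (n : ℕ) (γ γ' : ℕ → V), DiscreteGeodesic d n γ → DiscreteGeodesic d (n + 1) γ' →
      γ 0 = γ' 0 → d (γ n) (γ' (n + 1)) = 1 → ∀ i ≤ n, d (γ i) (γ' i) ≤ C := by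
    intro n γ γ' hγ hγ' h0 h1 i hi
    obtain ⟨η, hη, e0, e1⟩ := hG.exists_discreteGeodesic (γ n) (γ' (n + 1))
    rw [h1] at hη e1
    obtain ⟨θ, hθ, θ0, θ1⟩ := hγ.exists_append hG hη e0.symm (by
      rw [e1, h0, hγ' 0 (n + 1) (by omega) le_rfl]; omega)
    have := bigon _ θ γ' hθ hγ' (by rw [θ0 0 (by omega), h0]) (by rw [θ1, e1]) i (by omega)
    rwa [θ0 i hi] at this
  have level : ∀ (n : ℕ) (γ γ' : ℕ → V), DiscreteGeodesic d n γ → DiscreteGeodesic d n γ' →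
      γ 0 = γ' 0 → d (γ n) (γ' n) ≤ 1 → ∀ i ≤ n, d (γ i) (γ' i) ≤ 2 * C + 1 := by
    intro n γ γ' hγ hγ' h0 h1 i hi
    by_cases hz : d (γ n) (γ' n) = 0
    · exact (bigon n γ γ' hγ hγ' h0 (hG.eq_of_zero _ _ hz) i hi).trans (by omega)
    have h1 : d (γ n) (γ' n) = 1 := by omega
    obtain ⟨n, rfl⟩ : ∃ m, n = m + 1 := ⟨n - 1, by
      have : n ≠ 0 := by
        rintro rfl
        rw [h0, hG.self] at h1
        omega
      omega⟩
    obtain ⟨μ, hμ, m0, m1⟩ := hgeo (γ (n + 1)) (γ' (n + 1))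
    have hμ1 := hd (γ (n + 1)) (γ' (n + 1))
    rw [h1, Nat.cast_one] at hμ1
    rw [hμ1] at hμ m1
    have hμr := hμ.reverse
    have dv := hd (γ 0) (γ (n + 1))
    have dv' := hd (γ 0) (γ' (n + 1))
    rw [hγ 0 (n + 1) (by omega) le_rfl] at dv
    rw [h0, hγ' 0 (n + 1) (by omega) le_rfl, ← h0] at dv'
    push_cast [Nat.sub_zero] at dv dv'
    have e1 := hμ.dist_eq (s := 0) (t := 1 / 2) (by norm_num) (by norm_num) (by norm_num)
    have e2 := hμ.dist_eq (s := 1 / 2) (t := 1) (by norm_num) (by norm_num) (by norm_num)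
    rw [m0] at e1
    rw [m1] at e2
    rcases le_or_gt ((n : ℝ) + 3 / 2) (dist (μ (1 / 2)) (γ 0)) with hL | hL
    · obtain ⟨σ, hσ, hs⟩ := hγ.exists_segment hgeo hd
      obtain ⟨σ', hσ', hs'⟩ := hγ'.exists_segment hgeo hd
      have hs0 := hs 0 (Nat.zero_le _)
      have hs0' := hs' 0 (Nat.zero_le _)
      rw [Nat.cast_zero] at hs0 hs0'
      have hh : (1 : ℝ) - 1 / 2 = 1 / 2 := by norm_num
      obtain ⟨θ, hθ, θ0, θ1⟩ := hσ.exists_append (hμ.mono (M := 1 / 2) (by norm_num) (by norm_num))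
        (by rw [m0, hs _ le_rfl]) (by rw [hs0, dist_comm]; push_cast; linarith)
      obtain ⟨θ', hθ', θ0', θ1'⟩ := hσ'.exists_append
        (hμr.mono (M := 1 / 2) (by norm_num) (by norm_num))
        (by simp only [sub_zero, m1, hs' _ le_rfl])
        (by simp only [hh, hs0', ← h0]; rw [dist_comm]; push_cast; linarith)
      have := hC _ i θ θ' hθ hθ' (by rw [θ0 _ (by positivity), θ0' _ (by positivity), hs0, hs0', h0])
        (by rw [θ1 _ (by norm_num), θ1' _ (by norm_num), hh]) (by positivity)
        (by have : (i : ℝ) ≤ (n + 1 : ℕ) := by exact_mod_cast hi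
            linarith)
      rw [θ0 _ (by exact_mod_cast hi), θ0' _ (by exact_mod_cast hi), hs i hi, hs' i hi, hd] at this
      norm_cast at this
      omega
    · obtain ⟨Γ, hΓ, g0, g1⟩ := hgeo (μ (1 / 2)) (γ 0)
      set L := dist (μ (1 / 2)) (γ 0) with hLdef
      have hLn : (n : ℝ) + 1 / 2 ≤ L := by
        have := dist_triangle_right (γ 0 : X) (γ (n + 1)) (μ (1 / 2))
        rw [dist_comm (γ 0 : X) (μ (1 / 2))] at this
        linarith
      have hn0 : (0 : ℝ) ≤ n := by positivity
      obtain ⟨u, hu⟩ := hnet (Γ ((L - n + 1 / 2) / 2))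
      have a1 := hΓ.dist_eq (s := 0) (t := (L - n + 1 / 2) / 2) le_rfl (by linarith) (by linarith)
      have a2 := hΓ.dist_eq (s := (L - n + 1 / 2) / 2) (t := L) (by linarith) (by linarith) le_rfl
      rw [g0] at a1
      rw [g1] at a2
      have u1 := dist_triangle_left (γ 0 : X) u (Γ ((L - n + 1 / 2) / 2))
      have u2 := dist_triangle4 (γ (n + 1) : X) (μ (1 / 2)) (Γ ((L - n + 1 / 2) / 2)) u
      have u3 := dist_triangle4 (γ' (n + 1) : X) (μ (1 / 2)) (Γ ((L - n + 1 / 2) / 2)) u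
      rw [dist_comm (γ' (n + 1) : X) (μ (1 / 2))] at u3
      rw [hd] at u1 u2 u3
      have w1 : (d (γ 0) u : ℝ) < (n + 1 : ℕ) := by push_cast; linarith
      have w2 : (d (γ (n + 1)) u : ℝ) < (2 : ℕ) := by push_cast; linarith
      have w3 : (d (γ' (n + 1)) u : ℝ) < (2 : ℕ) := by push_cast; linarith
      rw [Nat.cast_lt] at w1 w2 w3
      rw [hG.symm] at w2 w3
      have v1 := hG.tri (γ 0) u (γ (n + 1))
      have v2 := hG.tri (γ 0) u (γ' (n + 1))
      have v3 := hγ 0 (n + 1) (by omega) le_rfl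
      have v4 := hγ' 0 (n + 1) (by omega) le_rfl
      rw [← h0] at v4
      obtain ⟨η, hη, q0, q1⟩ := hG.exists_discreteGeodesic (γ 0) u
      rw [show d (γ 0) u = n by omega] at hη q1
      rcases Nat.lt_or_ge n i with hin | hin
      · obtain rfl : i = n + 1 := by omega
        omega
      have s1 := succ n η γ hη hγ q0 (by rw [q1]; omega) i hin
      have s2 := succ n η γ' hη hγ' (q0.trans h0) (by rw [q1]; omega) i hin
      have s3 := hG.tri (γ i) (η i) (γ' i)
      rw [hG.symm (γ i) (η i)] at s3
      omega
  have half : ∀ (n n' : ℕ) (γ γ' : ℕ → V), n ≤ n' → DiscreteGeodesic d n γ →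
      DiscreteGeodesic d n' γ' → γ 0 = γ' 0 → d (γ n) (γ' n') ≤ 1 →
      ∀ i, d (γ (min i n)) (γ' (min i n')) ≤ 2 * C + 1 := by
    intro n n' γ γ' hn hγ hγ' h0 h1 i
    rcases hn.eq_or_lt with rfl | hlt
    · exact level n γ γ' hγ hγ' h0 h1 _ (min_le_right _ _)
    have t1 := hG.tri (γ 0) (γ n) (γ' n')
    rw [hγ 0 n (by omega) le_rfl, h0, hγ' 0 n' (by omega) le_rfl] at t1
    obtain rfl : n' = n + 1 := by omega
    rcases Nat.lt_or_ge n i with hin | hin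
    · rw [min_eq_right hin.le, min_eq_right hin]
      omega
    · rw [min_eq_left hin, min_eq_left (by omega)]
      exact (succ n γ γ' hγ hγ' h0 (by omega) i hin).trans (by omega)
  intro n n' γ γ' hγ hγ' h0 h1 i
  rcases le_total n n' with h | h
  · exact half n n' γ γ' h hγ hγ' h0 h1 i
  · rw [hG.symm]
    exact half n' n γ' γ h hγ' hγ h0.symm (by rwa [hG.symm]) i

/-- A geodesic segment and a discrete geodesic between vertices near its endpoints are within
bounded Hausdorff distance of each other. -/
theorem exists_dist_discreteGeodesic_le (hnet : ∀ x : X, ∃ v : V, dist x v ≤ 1 / 2)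
    (hd : ∀ v w : V, dist (v : X) w = d v w) (hG : IsGraphDist d) {K : ℕ}
    (hK : GeodesicsFellowTravel d K) :
    ∃ B : ℝ, ∀ (a : ℝ) (α : ℝ → X) (n : ℕ) (η : ℕ → V), IsGeodesicSegment a α →
      DiscreteGeodesic d n η → dist (α 0) (η 0) ≤ 1 / 2 → dist (α a) (η n) ≤ 1 / 2 →
      (∀ s ∈ Set.Icc (0 : ℝ) a, ∃ j ≤ n, dist (α s) (η j) ≤ B) ∧
      ∀ j ≤ n, ∃ s ∈ Set.Icc (0 : ℝ) a, dist (η j : X) (α s) ≤ B := by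
  obtain ⟨B, hB⟩ := hK.exists_dist_corner_le hG 3
  refine ⟨2 * B + 5 / 2, fun a α n η hα hη h0 h1 => ?_⟩
  have hB0 : (0 : ℝ) ≤ B := by positivity
  have hn := hd (η 0) (η n)
  rw [hη 0 n (Nat.zero_le _) le_rfl, Nat.sub_zero] at hn
  have ha := hα.dist_eq le_rfl hα.1 le_rfl
  have close : ∀ s ∈ Set.Icc (0 : ℝ) a, ∃ j ≤ n, dist (α s) (η j) ≤ B + 1 / 2 := by
    intro s hs
    obtain ⟨u, hu⟩ := hnet (α s)
    obtain ⟨τ₁, hτ₁, p0, p1⟩ := hG.exists_discreteGeodesic (η 0) u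
    obtain ⟨τ₂, hτ₂, q0, q1⟩ := hG.exists_discreteGeodesic u (η n)
    have a1 := hα.dist_eq le_rfl hs.1 hs.2
    have a2 := hα.dist_eq hs.1 hs.2 le_rfl
    have a3 := dist_triangle4_left (α 0) (α s) (η 0 : X) u
    have a4 := dist_triangle4_left (α s) (α a) (u : X) (η n)
    have a5 := dist_triangle4_right (α 0) (α a) (η 0 : X) (η n)
    rw [hd] at a3 a4
    have a6 : (d (η 0) u + d u (η n) : ℝ) ≤ (n + 3 : ℕ) := by push_cast; linarith
    have b := hB _ _ n τ₁ τ₂ η hτ₁ hτ₂ hη p0 (p1.trans q0.symm) q1 (by exact_mod_cast a6)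
    rw [p1] at b
    refine ⟨min (d (η 0) u) n, min_le_right _ _, (dist_triangle (α s) (u : X) _).trans ?_⟩
    rw [hd]
    have : (d u (η (min (d (η 0) u) n)) : ℝ) ≤ B := by exact_mod_cast b
    linarith
  refine ⟨fun s hs => ?_, fun j hj => ?_⟩
  · obtain ⟨j, hj, h⟩ := close s hs
    exact ⟨j, hj, by linarith⟩
  · have hs : min (j : ℝ) a ∈ Set.Icc (0 : ℝ) a :=
      ⟨le_min (by positivity) hα.1, min_le_right _ _⟩
    refine ⟨_, hs, ?_⟩
    obtain ⟨j', hj', h⟩ := close _ hs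
    have hjn : (j : ℝ) ≤ n := by exact_mod_cast hj
    have a1 := hα.dist_eq le_rfl hs.1 hs.2
    have a2 := dist_triangle4_left (α 0) (α a) (η 0 : X) (η n)
    have a3 : (j : ℝ) - 1 ≤ min (j : ℝ) a := le_min (by linarith) (by linarith)
    have a4 : min (j : ℝ) a ≤ j := min_le_left _ _
    have a5 := dist_triangle4_left (α 0) (α (min (j : ℝ) a)) (η 0 : X) (η j')
    have a6 := dist_triangle4_right (α 0) (α (min (j : ℝ) a)) (η 0 : X) (η j')
    have a7 := dist_triangle_right (η j : X) (α (min (j : ℝ) a)) (η j')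
    have e1 := hd (η 0) (η j')
    rw [hη 0 j' (Nat.zero_le _) hj', Nat.sub_zero] at e1
    rcases le_total j j' with hjj | hjj
    · have e2 := hd (η j) (η j')
      rw [hη j j' hjj hj', Nat.cast_sub hjj] at e2
      linarith
    · have e2 := hd (η j') (η j)
      rw [hη j' j hjj hj, Nat.cast_sub hjj, dist_comm] at e2
      linarith

end VertexNet

/-- Papasoglu's criterion: let `X` be (the metric realization of) a connected graph with
unit edges, i.e. a geodesic metric space containing a set `V` of vertices which is a
(1/2)-net and whose pairwise distances are integers.  If there is a constant `K` such
that for every bigon `σ, σ'` (two geodesics with common endpoints, which need not be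
vertices) each side lies in the `K`-neighborhood of the other, then `X` is hyperbolic. -/
theorem papasoglu_bigon_criterion {X : Type*} [MetricSpace X]
    (hgeo : IsGeodesicSpace X)
    (V : Set X)
    (hnet : ∀ x : X, ∃ v ∈ V, dist x v ≤ 1 / 2)
    (hint : ∀ v ∈ V, ∀ w ∈ V, ∃ m : ℕ, dist v w = (m : ℝ))
    (K : ℝ)
    (hbigon : ∀ (L : ℝ) (σ σ' : ℝ → X),
      IsGeodesicSegment L σ → IsGeodesicSegment L σ' →
      σ 0 = σ' 0 → σ L = σ' L →
      ∀ s ∈ Set.Icc (0:ℝ) L, ∃ t ∈ Set.Icc (0:ℝ) L, dist (σ s) (σ' t) ≤ K) :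
    ∃ δ : ℝ, DeltaHyperbolic X δ := by
  have hnet' : ∀ x : X, ∃ v : V, dist x v ≤ 1 / 2 := fun x =>
    let ⟨v, hv, h⟩ := hnet x
    ⟨⟨v, hv⟩, h⟩
  choose d hd using fun v w : V => hint v v.2 w w.2
  have hG := isGraphDist_of_net hgeo hnet' hd
  have hK := geodesicsFellowTravel_of_bigon hgeo hnet' hd (C := ⌈2 * K⌉₊)
    fun L s σ σ' hσ hσ' h0 h1 hs hsL =>
      (dist_le_of_bigon hbigon hσ hσ' h0 h1 hs hsL).trans (Nat.le_ceil _)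
  obtain ⟨δ, hδ⟩ := hK.thin_triangles hG (Nat.le_add_left _ _)
  obtain ⟨B, hB⟩ := exists_dist_discreteGeodesic_le hnet' hd hG hK
  refine ⟨B + δ + B, fun x y z a b c α β γ hα α0 α1 hβ β0 β1 hγ γ0 γ1 s hs => ?_⟩
  obtain ⟨u, hu⟩ := hnet' x
  obtain ⟨v, hv⟩ := hnet' y
  obtain ⟨w, hw⟩ := hnet' z
  obtain ⟨σ, hσ, σ0, σ1⟩ := hG.exists_discreteGeodesic u v
  obtain ⟨τ, hτ, τ0, τ1⟩ := hG.exists_discreteGeodesic w u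
  obtain ⟨ρ, hρ, ρ0, ρ1⟩ := hG.exists_discreteGeodesic w v
  obtain ⟨i, hi, hsi⟩ := (hB a α _ σ hα hσ (by rwa [α0, σ0]) (by rwa [α1, σ1])).1 s hs
  obtain ⟨j, ⟨hj, hij⟩ | ⟨hj, hij⟩⟩ := hδ _ _ _ σ τ ρ hσ hτ hρ (σ0.trans τ1.symm)
    (σ1.trans ρ1.symm) (τ0.trans ρ0.symm) i hi
  · obtain ⟨t, ht, hjt⟩ := (hB c γ _ τ hγ hτ (by rwa [γ0, τ0]) (by rwa [γ1, τ1])).2 j hj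
    refine ⟨γ t, Or.inr ⟨t, ht, rfl⟩, (dist_triangle4 _ (σ i : X) (τ j) _).trans ?_⟩
    have : (d (σ i) (τ j) : ℝ) ≤ δ := by exact_mod_cast hij
    rw [hd]
    linarith
  · obtain ⟨t, ht, hjt⟩ := (hB b _ _ ρ hβ.reverse hρ (by simpa [β1, ρ0] using hw)
      (by simpa [β0, ρ1] using hv)).2 j hj
    refine ⟨β (b - t), Or.inl ⟨b - t, ⟨by linarith [ht.2], by linarith [ht.1]⟩, rfl⟩,
      (dist_triangle4 _ (σ i : X) (ρ j) _).trans ?_⟩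
    have : (d (σ i) (ρ j) : ℝ) ≤ δ := by exact_mod_cast hij
    rw [hd]
    linarith
end
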